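/- arXiv:1805.03570 — 5 statements merged into one kernel-verified Lean document; each statement's English description precedes it below -/
import Mathlib

section
/- There exist constants 0 < C1 ≤ C2 < ∞ such that liminf_{|t|→∞} ρ(t)^{2−Q}·|r(t)| ≥ C1 and limsup_{|t|→∞} ρ(t)^{2−Q}·|r(t)| ≤ C2, where the liminf and limsup are taken over t ∈ ℤ³ as |t| → ∞. -/
open Filter

theorem sum_range_rpow_neg_le {β : ℝ} (h0 : 0 < β) (h1 : β < 1) (K : ℕ) :
    ∑ n ∈ Finset.range K, ((n : ℝ) + 1) ^ (-β) ≤ (K : ℝ) ^ (1 - β) / (1 - β) := by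
  induction K with
  | zero => simp [Real.zero_rpow (by linarith : (1 - β) ≠ 0)]
  | succ k ih =>
    rw [Finset.sum_range_succ]
    have hk : (0 : ℝ) < (k : ℝ) + 1 := by positivity
    have hb := rpow_one_add_le_one_add_mul_self (s := -(1 / ((k : ℝ) + 1))) (p := 1 - β)
      (by rw [neg_le_neg_iff, div_le_one hk]; linarith [(Nat.cast_nonneg k : (0 : ℝ) ≤ k)])
      (by linarith) (by linarith)
    have e1 : 1 + -(1 / ((k : ℝ) + 1)) = k / (k + 1) := by field_simp; ring
    rw [e1, Real.div_rpow (by positivity) hk.le, div_le_iff₀ (by positivity)] at hb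
    have e2 : ((k : ℝ) + 1) ^ (1 - β) = (k + 1) * (k + 1) ^ (-β) := by
      rw [sub_eq_add_neg, Real.rpow_add hk, Real.rpow_one]
    have e3 : (1 + (1 - β) * -(1 / ((k : ℝ) + 1))) * ((k : ℝ) + 1) ^ (1 - β)
        = (k + 1) ^ (1 - β) - (1 - β) * (k + 1) ^ (-β) := by
      rw [e2]; field_simp; ring
    rw [e3] at hb
    push_cast
    rw [le_div_iff₀ (by linarith)] at ih ⊢
    nlinarith

theorem sum_range_add_rpow_neg_le {p : ℝ} (hp : 1 < p) {K : ℕ} (hK : 1 ≤ K) (m : ℕ) :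
    ∑ n ∈ Finset.range m, (((K + n : ℕ) : ℝ) + 1) ^ (-p) ≤
      ((K : ℝ) ^ (1 - p) - ((K + m : ℕ) : ℝ) ^ (1 - p)) / (p - 1) := by
  induction m with
  | zero => simp
  | succ k ih =>
    rw [Finset.sum_range_succ]
    rw [← add_assoc K k 1, Nat.cast_add (K + k) 1, Nat.cast_one]
    generalize hx : (((K + k : ℕ) : ℝ)) = x at *
    have hx1 : (1 : ℝ) ≤ x := by rw [← hx]; exact_mod_cast (by omega)
    have hx0 : (0 : ℝ) < x := by linarith
    have hk : (0 : ℝ) < x + 1 := by positivity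
    have hb := one_add_mul_self_le_rpow_one_add (s := 1 / x) (p := p)
      (by have : 0 < 1 / x := by positivity
          linarith) hp.le
    have e1 : 1 + 1 / x = (x + 1) / x := by field_simp
    rw [e1, Real.div_rpow hk.le hx0.le, le_div_iff₀ (by positivity)] at hb
    have e2 : x ^ (1 - p) = x * (x ^ p)⁻¹ := by
      rw [sub_eq_add_neg, Real.rpow_add hx0, Real.rpow_one, Real.rpow_neg hx0.le]
    have e3 : (x + 1) ^ (1 - p) = (x + 1) * ((x + 1) ^ p)⁻¹ := by
      rw [sub_eq_add_neg, Real.rpow_add hk, Real.rpow_one, Real.rpow_neg hk.le]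
    rw [le_div_iff₀ (by linarith)] at ih ⊢
    have hX : 0 < x ^ p := by positivity
    have hY : 0 < (x + 1) ^ p := by positivity
    have key : (p - 1) * (x + 1) ^ (-p) ≤ x ^ (1 - p) - (x + 1) ^ (1 - p) := by
      rw [e2, e3, Real.rpow_neg hk.le]
      generalize x ^ p = X at *
      generalize (x + 1) ^ p = Y at *
      have : (p + x) * Y⁻¹ ≤ x * X⁻¹ := by
        rw [← div_eq_mul_inv, ← div_eq_mul_inv, div_le_div_iff₀ hY hX]
        have := mul_le_mul_of_nonneg_left hb hx0.le
        have e4 : x * ((1 + p * (1 / x)) * X) = (p + x) * X := by field_simp; ring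
        linarith
      linarith
    linarith

theorem sum_range_rpow_mul_max_le {β : ℝ} (h0 : 1 / 2 < β) (h1 : β < 1) {R : ℝ} (hR : 1 ≤ R)
    (m : ℕ) :
    ∑ n ∈ Finset.range m, ((n : ℝ) + 1) ^ (-β) * max ((n : ℝ) + 1) R ^ (-β) ≤
      (1 / (1 - β) + 2 ^ (2 * β - 1) / (2 * β - 1)) * R ^ (1 - 2 * β) := by
  have hR0 : 0 < R := by linarith
  set K := ⌊R⌋₊ with hKdef
  have hK : 1 ≤ K := Nat.one_le_floor_iff R |>.2 hR
  have hKR : (K : ℝ) ≤ R := Nat.floor_le hR0.le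
  have hRK : R < K + 1 := Nat.lt_floor_add_one R
  have hK' : (1 : ℝ) ≤ K := by exact_mod_cast hK
  have hf0 : ∀ n : ℕ, 0 ≤ ((n : ℝ) + 1) ^ (-β) * max ((n : ℝ) + 1) R ^ (-β) := fun n => by
    positivity
  calc _ ≤ ∑ n ∈ Finset.range (K + m), ((n : ℝ) + 1) ^ (-β) * max ((n : ℝ) + 1) R ^ (-β) :=
        Finset.sum_le_sum_of_subset_of_nonneg
          (Finset.range_subset_range.2 (by omega)) (fun i _ _ => hf0 i)
    _ = ∑ n ∈ Finset.range K, ((n : ℝ) + 1) ^ (-β) * max ((n : ℝ) + 1) R ^ (-β) +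
        ∑ n ∈ Finset.range m, (((K + n : ℕ) : ℝ) + 1) ^ (-β) *
          max (((K + n : ℕ) : ℝ) + 1) R ^ (-β) := by rw [Finset.sum_range_add]
    _ ≤ ∑ n ∈ Finset.range K, ((n : ℝ) + 1) ^ (-β) * R ^ (-β) +
        ∑ n ∈ Finset.range m, (((K + n : ℕ) : ℝ) + 1) ^ (-(2 * β)) := by
      gcongr ?_ + ?_
      · refine Finset.sum_le_sum fun n _ => ?_
        refine mul_le_mul_of_nonneg_left ?_ (by positivity)
        exact Real.rpow_le_rpow_of_nonpos hR0 (le_max_right _ _) (by linarith)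
      · refine Finset.sum_le_sum fun n _ => ?_
        have hx : (0 : ℝ) < ((K + n : ℕ) : ℝ) + 1 := by positivity
        rw [show -(2 * β) = -β + -β by ring, Real.rpow_add hx]
        refine mul_le_mul_of_nonneg_left ?_ (by positivity)
        exact Real.rpow_le_rpow_of_nonpos hx (le_max_left _ _) (by linarith)
    _ ≤ R ^ (1 - β) / (1 - β) * R ^ (-β) + (R / 2) ^ (1 - 2 * β) / (2 * β - 1) := by
      gcongr ?_ + ?_
      · rw [← Finset.sum_mul]
        gcongr
        refine (sum_range_rpow_neg_le (by linarith) h1 K).trans ?_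
        have : 0 ≤ 1 - β := by linarith
        gcongr
      · refine (sum_range_add_rpow_neg_le (by linarith) hK m).trans ?_
        have : 0 < 2 * β - 1 := by linarith
        gcongr
        have : (K : ℝ) ^ (1 - 2 * β) ≤ (R / 2) ^ (1 - 2 * β) :=
          Real.rpow_le_rpow_of_nonpos (by linarith) (by linarith) (by linarith)
        have : 0 ≤ ((K + m : ℕ) : ℝ) ^ (1 - 2 * β) := by positivity
        linarith
    _ = _ := by
      have e1 : R ^ (1 - 2 * β) = R ^ (1 - β) * R ^ (-β) := by
        rw [← Real.rpow_add hR0]; ring_nf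
      have e2 : (R / 2) ^ (1 - 2 * β) = R ^ (1 - 2 * β) * 2 ^ (2 * β - 1) := by
        rw [Real.div_rpow hR0.le (by norm_num), div_eq_mul_inv, ← Real.rpow_neg (by norm_num)]
        ring_nf
      rw [e2, e1]; ring

/-- The truncated absolute value `max |n| 1`. -/
noncomputable def truncAbs (n : ℤ) : ℝ := max |(n : ℝ)| 1

theorem one_le_truncAbs (n : ℤ) : 1 ≤ truncAbs n := le_max_right _ _

theorem truncAbs_pos (n : ℤ) : 0 < truncAbs n := one_pos.trans_le (one_le_truncAbs n)

theorem truncAbs_nat_add_one (n : ℕ) : truncAbs (n + 1) = n + 1 := by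
  have : (0 : ℝ) ≤ n := n.cast_nonneg
  simp only [truncAbs]
  push_cast
  rw [abs_of_nonneg (by linarith), max_eq_left (by linarith)]

theorem truncAbs_neg (n : ℤ) : truncAbs (-n) = truncAbs n := by simp [truncAbs]

theorem exists_hasSum_truncAbs_le {β : ℝ} (h0 : 1 / 2 < β) (h1 : β < 1) :
    ∃ C : ℝ, 0 < C ∧ ∀ R : ℝ, 1 ≤ R → ∃ S : ℝ,
      HasSum (fun n : ℤ => truncAbs n ^ (-β) * max (truncAbs n) R ^ (-β)) S ∧
      S ≤ C * R ^ (1 - 2 * β) := by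
  set C0 := 1 / (1 - β) + 2 ^ (2 * β - 1) / (2 * β - 1) with hC0
  have hC0' : 0 < C0 := by
    have : 0 < 1 - β := by linarith
    have : 0 < 2 * β - 1 := by linarith
    positivity
  refine ⟨2 * C0 + 1, by positivity, fun R hR => ?_⟩
  have hR0 : 0 < R := by linarith
  set F : ℕ → ℝ := fun n => ((n : ℝ) + 1) ^ (-β) * max ((n : ℝ) + 1) R ^ (-β) with hF
  have hF0 : ∀ n, 0 ≤ F n := fun n => by positivity
  have hFle := sum_range_rpow_mul_max_le h0 h1 hR
  have hs : Summable F := summable_of_sum_range_le hF0 hFle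
  have ht : ∑' n, F n ≤ C0 * R ^ (1 - 2 * β) := Real.tsum_le_of_sum_range_le hF0 hFle
  set f : ℤ → ℝ := fun n => truncAbs n ^ (-β) * max (truncAbs n) R ^ (-β) with hf
  have h2 : HasSum (fun n : ℕ => f n) (∑' n, F n + f 0) := by
    have : HasSum (fun n : ℕ => f ((n + 1 : ℕ) : ℤ)) (∑' n, F n) := by
      convert hs.hasSum using 2 with n
      simp only [hf, hF]
      push_cast
      rw [truncAbs_nat_add_one]
    have := (hasSum_nat_add_iff (f := fun n : ℕ => f n) 1).1 this
    simpa using this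
  have h3 : HasSum (fun n : ℕ => f (-(n + 1))) (∑' n, F n) := by
    convert hs.hasSum using 2 with n
    simp only [hf, hF]
    rw [truncAbs_neg, truncAbs_nat_add_one]
  refine ⟨_, h2.of_nat_of_neg_add_one h3, ?_⟩
  have hf0 : f 0 ≤ R ^ (1 - 2 * β) := by
    have : truncAbs 0 = 1 := by simp [truncAbs]
    simp only [hf, this, Real.one_rpow, one_mul, max_eq_right hR]
    exact Real.rpow_le_rpow_of_exponent_le hR (by linarith)
  linarith

/-- The anisotropic gauge `max_i max(|t_i|, 1) ^ q_i`. -/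
noncomputable def anisoGauge (q1 q2 q3 : ℝ) (t : ℤ × ℤ × ℤ) : ℝ :=
  max (truncAbs t.1 ^ q1) (max (truncAbs t.2.1 ^ q2) (truncAbs t.2.2 ^ q3))

section Gauge

variable {q1 q2 q3 : ℝ}

theorem anisoGauge_le_iff {t : ℤ × ℤ × ℤ} {x : ℝ} : anisoGauge q1 q2 q3 t ≤ x ↔
    truncAbs t.1 ^ q1 ≤ x ∧ truncAbs t.2.1 ^ q2 ≤ x ∧ truncAbs t.2.2 ^ q3 ≤ x := by
  simp [anisoGauge]

theorem one_le_anisoGauge (h1 : 0 < q1) (t : ℤ × ℤ × ℤ) : 1 ≤ anisoGauge q1 q2 q3 t :=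
  (Real.one_le_rpow (one_le_truncAbs t.1) h1.le).trans (le_max_left _ _)

theorem truncAbs_rpow_le_of_add {q : ℝ} (hq : 0 < q) {m n : ℤ} {x : ℝ}
    (hm : truncAbs m ^ q ≤ x) (hn : truncAbs (n + m) ^ q ≤ x) : truncAbs n ^ q ≤ 2 ^ q * x := by
  have hm0 := truncAbs_pos m
  have hn0 := truncAbs_pos (n + m)
  have hx : 0 ≤ x := (Real.rpow_nonneg hm0.le q).trans hm
  have h1 : truncAbs m ≤ x ^ q⁻¹ := (Real.le_rpow_inv_iff_of_pos hm0.le hx hq).2 hm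
  have h2 : truncAbs (n + m) ≤ x ^ q⁻¹ := (Real.le_rpow_inv_iff_of_pos hn0.le hx hq).2 hn
  have h3 : truncAbs n ≤ truncAbs (n + m) + truncAbs m := by
    refine max_le ?_ ((one_le_truncAbs m).trans (by linarith))
    have : (n : ℝ) = ((n + m : ℤ) : ℝ) - m := by push_cast; ring
    rw [this]
    exact (abs_sub _ _).trans (add_le_add (le_max_left _ _) (le_max_left _ _))
  calc truncAbs n ^ q ≤ (2 * x ^ q⁻¹) ^ q :=
        Real.rpow_le_rpow (truncAbs_pos n).le (by linarith) hq.le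
    _ = 2 ^ q * x := by
      rw [Real.mul_rpow (by norm_num) (by positivity), Real.rpow_inv_rpow hx hq.ne']

theorem anisoGauge_le_of_add (h1 : 0 < q1) (h2 : 0 < q2) (h3 : 0 < q3) (s t : ℤ × ℤ × ℤ) {x : ℝ}
    (hs : anisoGauge q1 q2 q3 s ≤ x) (hts : anisoGauge q1 q2 q3 (t + s) ≤ x) :
    anisoGauge q1 q2 q3 t ≤ 2 ^ (q1 + q2 + q3) * x := by
  have hx : 0 ≤ x := zero_le_one.trans ((one_le_anisoGauge h1 s).trans hs)
  rw [anisoGauge_le_iff] at *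
  have key : ∀ q : ℝ, q ≤ q1 + q2 + q3 → (2 : ℝ) ^ q * x ≤ 2 ^ (q1 + q2 + q3) * x := fun q hq =>
    mul_le_mul_of_nonneg_right (Real.rpow_le_rpow_of_exponent_le (by norm_num) hq) hx
  exact ⟨(truncAbs_rpow_le_of_add h1 hs.1 hts.1).trans (key _ (by linarith)),
    (truncAbs_rpow_le_of_add h2 hs.2.1 hts.2.1).trans (key _ (by linarith)),
    (truncAbs_rpow_le_of_add h3 hs.2.2 hts.2.2).trans (key _ (by linarith))⟩

theorem anisoGauge_neg (t : ℤ × ℤ × ℤ) : anisoGauge q1 q2 q3 (-t) = anisoGauge q1 q2 q3 t := by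
  simp [anisoGauge, truncAbs_neg]

theorem anisoGauge_add_le (h1 : 0 < q1) (h2 : 0 < q2) (h3 : 0 < q3) (s t : ℤ × ℤ × ℤ) {x : ℝ}
    (hs : anisoGauge q1 q2 q3 s ≤ x) (ht : anisoGauge q1 q2 q3 t ≤ x) :
    anisoGauge q1 q2 q3 (t + s) ≤ 2 ^ (q1 + q2 + q3) * x :=
  anisoGauge_le_of_add h1 h2 h3 (-s) (t + s) (by rwa [anisoGauge_neg]) (by simpa using ht)

theorem le_rpow_one_div {q x y : ℝ} (hq : 0 < q) (hx : 0 ≤ x) (h : x ^ q ≤ y) :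
    x ≤ y ^ (1 / q) := by
  rw [one_div]
  exact (Real.le_rpow_inv_iff_of_pos hx ((Real.rpow_nonneg hx q).trans h) hq).2 h

theorem inv_le_prod_rpow_neg {Q X x1 x2 x3 : ℝ} (hQ : Q = 1 / q1 + 1 / q2 + 1 / q3) (hQ0 : 0 < Q)
    (hX : 0 < X) (hx1 : 0 < x1) (hx2 : 0 < x2) (hx3 : 0 < x3)
    (h1 : x1 ≤ X ^ (1 / q1)) (h2 : x2 ≤ X ^ (1 / q2)) (h3 : x3 ≤ X ^ (1 / q3)) :
    X⁻¹ ≤ x1 ^ (-(1 / Q)) * (x2 ^ (-(1 / Q)) * x3 ^ (-(1 / Q))) := by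
  have hb : -(1 / Q) ≤ 0 := by
    have : 0 < 1 / Q := by positivity
    linarith
  have e : X⁻¹ = (X ^ (1 / q1)) ^ (-(1 / Q)) *
      ((X ^ (1 / q2)) ^ (-(1 / Q)) * (X ^ (1 / q3)) ^ (-(1 / Q))) := by
    rw [← Real.rpow_mul hX.le, ← Real.rpow_mul hX.le, ← Real.rpow_mul hX.le,
      ← Real.rpow_add hX, ← Real.rpow_add hX, ← Real.rpow_neg_one]
    congr 1
    rw [← add_mul, ← add_mul, ← add_assoc, ← hQ]
    field_simp
  rw [e]
  have g1 := Real.rpow_le_rpow_of_nonpos hx1 h1 hb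
  have g2 := Real.rpow_le_rpow_of_nonpos hx2 h2 hb
  have g3 := Real.rpow_le_rpow_of_nonpos hx3 h3 hb
  gcongr

theorem exists_tsum_inv_anisoGauge_le (h1 : 0 < q1) (h2 : 0 < q2) (h3 : 0 < q3)
    (hQ1 : 1 < 1 / q1 + 1 / q2 + 1 / q3) (hQ2 : 1 / q1 + 1 / q2 + 1 / q3 < 2) :
    ∃ C : ℝ, 0 < C ∧ ∀ N : ℝ, 1 ≤ N →
      Summable (fun s => (anisoGauge q1 q2 q3 s * max (anisoGauge q1 q2 q3 s) N)⁻¹) ∧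
      ∑' s, (anisoGauge q1 q2 q3 s * max (anisoGauge q1 q2 q3 s) N)⁻¹ ≤
        C * N ^ ((1 / q1 + 1 / q2 + 1 / q3) - 2) := by
  obtain ⟨Q, hQ⟩ : ∃ Q, Q = 1 / q1 + 1 / q2 + 1 / q3 := ⟨_, rfl⟩
  rw [← hQ] at hQ1 hQ2 ⊢
  have hQ0 : 0 < Q := by linarith
  obtain ⟨C, hC, hsum⟩ := exists_hasSum_truncAbs_le (β := 1 / Q)
    (one_div_lt_one_div_of_lt hQ0 hQ2) (by rw [div_lt_one hQ0]; exact hQ1)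
  refine ⟨C ^ 3, by positivity, fun N hN => ?_⟩
  have hN0 : 0 < N := by linarith
  have hR : ∀ q : ℝ, 0 < q → 1 ≤ N ^ (1 / q) := fun q hq => Real.one_le_rpow hN (by positivity)
  set f : ℝ → ℤ → ℝ := fun q n =>
    truncAbs n ^ (-(1 / Q)) * max (truncAbs n) (N ^ (1 / q)) ^ (-(1 / Q)) with hf
  have hf0 : ∀ q n, 0 ≤ f q n := fun q n => by
    have := truncAbs_pos n
    positivity
  obtain ⟨S1, hS1, hS1'⟩ := hsum _ (hR q1 h1)
  obtain ⟨S2, hS2, hS2'⟩ := hsum _ (hR q2 h2)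
  obtain ⟨S3, hS3, hS3'⟩ := hsum _ (hR q3 h3)
  change HasSum (f q1) S1 at hS1
  change HasSum (f q2) S2 at hS2
  change HasSum (f q3) S3 at hS3
  have hs23 := hS2.summable.mul_of_nonneg hS3.summable (hf0 q2) (hf0 q3)
  have hH23 : HasSum (fun x : ℤ × ℤ => f q2 x.1 * f q3 x.2) (S2 * S3) := hS2.mul hS3 hs23
  have hs123 := hS1.summable.mul_of_nonneg hH23.summable (hf0 q1)
    (fun x => mul_nonneg (hf0 q2 _) (hf0 q3 _))
  have hH := hS1.mul hH23 hs123
  have hle : ∀ s : ℤ × ℤ × ℤ, (anisoGauge q1 q2 q3 s * max (anisoGauge q1 q2 q3 s) N)⁻¹ ≤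
      f q1 s.1 * (f q2 s.2.1 * f q3 s.2.2) := by
    intro s
    have hX1 := one_le_anisoGauge (q2 := q2) (q3 := q3) h1 s
    obtain ⟨l1, l2, l3⟩ := anisoGauge_le_iff.1 (le_refl (anisoGauge q1 q2 q3 s))
    generalize anisoGauge q1 q2 q3 s = X at *
    have hX : 0 < X := by linarith
    have p1 := truncAbs_pos s.1
    have p2 := truncAbs_pos s.2.1
    have p3 := truncAbs_pos s.2.2
    have l1 := le_rpow_one_div h1 p1.le l1
    have l2 := le_rpow_one_div h2 p2.le l2
    have l3 := le_rpow_one_div h3 p3.le l3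
    have hm : ∀ q y : ℝ, 0 < q → y ≤ X ^ (1 / q) →
        max y (N ^ (1 / q)) ≤ (max X N) ^ (1 / q) := fun q y hq hy =>
      max_le (hy.trans (Real.rpow_le_rpow hX.le (le_max_left _ _) (by positivity)))
        (Real.rpow_le_rpow hN0.le (le_max_right _ _) (by positivity))
    have A := inv_le_prod_rpow_neg hQ hQ0 hX p1 p2 p3 l1 l2 l3
    have B := inv_le_prod_rpow_neg hQ hQ0 (lt_max_of_lt_left hX) (lt_max_of_lt_left p1)
      (lt_max_of_lt_left p2) (lt_max_of_lt_left p3) (hm q1 _ h1 l1) (hm q2 _ h2 l2) (hm q3 _ h3 l3)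
    rw [mul_inv]
    refine (mul_le_mul A B (by positivity) (by positivity)).trans (le_of_eq ?_)
    simp only [hf]
    ring
  have hnn : ∀ s : ℤ × ℤ × ℤ,
      0 ≤ (anisoGauge q1 q2 q3 s * max (anisoGauge q1 q2 q3 s) N)⁻¹ := fun s => by
    have : 0 < anisoGauge q1 q2 q3 s := one_pos.trans_le (one_le_anisoGauge h1 s)
    positivity
  have hsm := Summable.of_nonneg_of_le hnn hle hH.summable
  refine ⟨hsm, (hsm.tsum_le_tsum hle hH.summable).trans ?_⟩
  rw [hH.tsum_eq]
  have z2 : 0 ≤ S2 := hS2.nonneg (hf0 q2)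
  have z3 : 0 ≤ S3 := hS3.nonneg (hf0 q3)
  calc S1 * (S2 * S3) ≤ (C * (N ^ (1 / q1)) ^ (1 - 2 * (1 / Q))) *
        ((C * (N ^ (1 / q2)) ^ (1 - 2 * (1 / Q))) * (C * (N ^ (1 / q3)) ^ (1 - 2 * (1 / Q)))) := by
        gcongr
    _ = C ^ 3 * ((N ^ (1 / q1)) ^ (1 - 2 * (1 / Q)) *
        ((N ^ (1 / q2)) ^ (1 - 2 * (1 / Q)) * (N ^ (1 / q3)) ^ (1 - 2 * (1 / Q)))) := by ring
    _ = C ^ 3 * N ^ (Q - 2) := by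
      rw [← Real.rpow_mul hN0.le, ← Real.rpow_mul hN0.le, ← Real.rpow_mul hN0.le,
        ← Real.rpow_add hN0, ← Real.rpow_add hN0]
      congr 2
      rw [← add_mul, ← add_mul, ← add_assoc, ← hQ]
      field_simp

theorem exists_finset_anisoGauge_le (h1 : 0 < q1) (h2 : 0 < q2) (h3 : 0 < q3) {N : ℝ}
    (hN : 1 ≤ N) : ∃ B : Finset (ℤ × ℤ × ℤ),
      N ^ (1 / q1 + 1 / q2 + 1 / q3) ≤ B.card ∧ ∀ s ∈ B, anisoGauge q1 q2 q3 s ≤ N := by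
  have hN0 : 0 < N := by linarith
  set I : ℝ → Finset ℤ := fun q => Finset.Icc 0 ⌊N ^ (1 / q)⌋ with hI
  have hcard : ∀ q : ℝ, N ^ (1 / q) ≤ (I q).card := by
    intro q
    have h0 : 0 ≤ ⌊N ^ (1 / q)⌋ := Int.floor_nonneg.2 (by positivity)
    have h' : ((I q).card : ℤ) = ⌊N ^ (1 / q)⌋ + 1 := by
      rw [hI, Int.card_Icc, Int.toNat_of_nonneg (by omega)]; ring
    have h'' : ((I q).card : ℝ) = ⌊N ^ (1 / q)⌋ + 1 := by exact_mod_cast h'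
    rw [h'']
    exact (Int.lt_floor_add_one _).le
  have hmem : ∀ q : ℝ, 0 < q → ∀ n ∈ I q, truncAbs n ^ q ≤ N := by
    intro q hq n hn
    have hR : 1 ≤ N ^ (1 / q) := Real.one_le_rpow hN (by positivity)
    have : truncAbs n ≤ N ^ (1 / q) := by
      refine max_le ?_ hR
      obtain ⟨hn0, hn⟩ := Finset.mem_Icc.1 hn
      rw [abs_of_nonneg (by exact_mod_cast hn0)]
      exact Int.le_floor.1 hn
    calc truncAbs n ^ q ≤ (N ^ (1 / q)) ^ q :=
          Real.rpow_le_rpow (truncAbs_pos n).le this hq.le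
      _ = N := by rw [one_div, Real.rpow_inv_rpow hN0.le hq.ne']
  refine ⟨I q1 ×ˢ (I q2 ×ˢ I q3), ?_, fun s hs => ?_⟩
  · rw [Finset.card_product, Finset.card_product, Real.rpow_add hN0, Real.rpow_add hN0, mul_assoc]
    push_cast
    have := hcard q1
    have := hcard q2
    have := hcard q3
    gcongr
  · simp only [Finset.mem_product] at hs
    exact anisoGauge_le_iff.2 ⟨hmem q1 h1 _ hs.1, hmem q2 h2 _ hs.2.1, hmem q3 h3 _ hs.2.2⟩

theorem tendsto_anisoGauge (h1 : 0 < q1) (h2 : 0 < q2) (h3 : 0 < q3) :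
    Tendsto (anisoGauge q1 q2 q3) cofinite atTop := by
  refine tendsto_atTop.2 fun M => ?_
  have hI : ∀ q : ℝ, 0 < q → ∀ n : ℤ, truncAbs n ^ q ≤ M →
      n ∈ Set.Icc (-⌊M ^ (1 / q)⌋) ⌊M ^ (1 / q)⌋ := by
    intro q hq n hn
    have := (le_max_left _ _).trans (le_rpow_one_div hq (truncAbs_pos n).le hn)
    rw [abs_le] at this
    refine ⟨?_, Int.le_floor.2 this.2⟩
    have : -n ≤ ⌊M ^ (1 / q)⌋ := Int.le_floor.2 (by push_cast; linarith)
    omega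
  refine Set.Finite.subset (((Set.finite_Icc (-⌊M ^ (1 / q1)⌋) ⌊M ^ (1 / q1)⌋).prod
    ((Set.finite_Icc (-⌊M ^ (1 / q2)⌋) ⌊M ^ (1 / q2)⌋).prod
      (Set.finite_Icc (-⌊M ^ (1 / q3)⌋) ⌊M ^ (1 / q3)⌋)))) fun s hs => ?_
  have hs : anisoGauge q1 q2 q3 s < M := not_le.1 hs
  obtain ⟨l1, l2, l3⟩ := anisoGauge_le_iff.1 hs.le
  exact ⟨hI q1 h1 _ l1, hI q2 h2 _ l2, hI q3 h3 _ l3⟩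

end Gauge

section Autocovariance

variable {q1 q2 q3 : ℝ}

theorem inv_le_mul_inv_mul_max {κ N x y : ℝ} (hκ : 1 ≤ κ) (hx : 0 < x)
    (hxy : x ≤ y) (hNy : N ≤ κ * y) : (x * y)⁻¹ ≤ κ * (x * max x N)⁻¹ := by
  have hy : 0 < y := hx.trans_le hxy
  have hm : max x N ≤ κ * y := max_le (by nlinarith) hNy
  have hm0 : 0 < max x N := lt_max_of_lt_left hx
  rw [← div_eq_mul_inv, inv_eq_one_div, div_le_div_iff₀ (by positivity) (by positivity)]
  nlinarith [mul_le_mul_of_nonneg_left hm hx.le]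

theorem anisoGauge_le_mul_max (h1 : 0 < q1) (h2 : 0 < q2) (h3 : 0 < q3) (s t : ℤ × ℤ × ℤ) :
    anisoGauge q1 q2 q3 t ≤
      2 ^ (q1 + q2 + q3) * max (anisoGauge q1 q2 q3 s) (anisoGauge q1 q2 q3 (t + s)) :=
  anisoGauge_le_of_add h1 h2 h3 s t (le_max_left _ _) (le_max_right _ _)

theorem inv_anisoGauge_mul_le (h1 : 0 < q1) (h2 : 0 < q2) (h3 : 0 < q3) (s t : ℤ × ℤ × ℤ) :
    (anisoGauge q1 q2 q3 s * anisoGauge q1 q2 q3 (t + s))⁻¹ ≤ 2 ^ (q1 + q2 + q3) *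
      ((anisoGauge q1 q2 q3 s * max (anisoGauge q1 q2 q3 s) (anisoGauge q1 q2 q3 t))⁻¹ +
        (anisoGauge q1 q2 q3 (t + s) *
          max (anisoGauge q1 q2 q3 (t + s)) (anisoGauge q1 q2 q3 t))⁻¹) := by
  have hκ : (1 : ℝ) ≤ 2 ^ (q1 + q2 + q3) := Real.one_le_rpow (by norm_num) (by linarith)
  have hmax := anisoGauge_le_mul_max h1 h2 h3 s t
  have hx := one_pos.trans_le (one_le_anisoGauge (q2 := q2) (q3 := q3) h1 s)
  have hy := one_pos.trans_le (one_le_anisoGauge (q2 := q2) (q3 := q3) h1 (t + s))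
  generalize anisoGauge q1 q2 q3 t = N at *
  generalize anisoGauge q1 q2 q3 s = x at *
  generalize anisoGauge q1 q2 q3 (t + s) = y at *
  have px : 0 ≤ (x * max x N)⁻¹ := by positivity
  have py : 0 ≤ (y * max y N)⁻¹ := by positivity
  rw [mul_add]
  rcases le_total x y with hxy | hxy
  · rw [max_eq_right hxy] at hmax
    have := inv_le_mul_inv_mul_max hκ hx hxy hmax
    nlinarith
  · rw [max_eq_left hxy] at hmax
    have := inv_le_mul_inv_mul_max hκ hy hxy hmax
    rw [mul_comm y x] at this
    nlinarith

theorem inv_anisoGauge_mul_le_inv (h1 : 0 < q1) (h2 : 0 < q2) (h3 : 0 < q3)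
    (s t : ℤ × ℤ × ℤ) : (anisoGauge q1 q2 q3 s * anisoGauge q1 q2 q3 (t + s))⁻¹ ≤
      2 ^ (q1 + q2 + q3) * (anisoGauge q1 q2 q3 t)⁻¹ := by
  have hmax := anisoGauge_le_mul_max h1 h2 h3 s t
  have hN := one_le_anisoGauge (q2 := q2) (q3 := q3) h1 t
  have hx := one_le_anisoGauge (q2 := q2) (q3 := q3) h1 s
  have hy := one_le_anisoGauge (q2 := q2) (q3 := q3) h1 (t + s)
  have hle : max (anisoGauge q1 q2 q3 s) (anisoGauge q1 q2 q3 (t + s)) ≤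
      anisoGauge q1 q2 q3 s * anisoGauge q1 q2 q3 (t + s) := max_le (by nlinarith) (by nlinarith)
  rw [← div_eq_mul_inv, inv_eq_one_div, div_le_div_iff₀ (by positivity) (by positivity), one_mul]
  exact hmax.trans (mul_le_mul_of_nonneg_left hle (by positivity))

theorem summable_and_abs_tsum_mul_shift_le (h1 : 0 < q1) (h2 : 0 < q2) (h3 : 0 < q3)
    (hQ1 : 1 < 1 / q1 + 1 / q2 + 1 / q3) (hQ2 : 1 / q1 + 1 / q2 + 1 / q3 < 2)
    {a : ℤ × ℤ × ℤ → ℝ} {K : ℝ} (hK : ∀ s, |a s| ≤ K * (anisoGauge q1 q2 q3 s)⁻¹) :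
    ∃ C : ℝ, 0 < C ∧ ∀ t, Summable (fun s => a s * a (t + s)) ∧
      |∑' s, a s * a (t + s)| ≤
        C * anisoGauge q1 q2 q3 t ^ ((1 / q1 + 1 / q2 + 1 / q3) - 2) := by
  obtain ⟨C, hC, hsum⟩ := exists_tsum_inv_anisoGauge_le h1 h2 h3 hQ1 hQ2
  set κ : ℝ := 2 ^ (q1 + q2 + q3) with hκ
  have hκ0 : 0 < κ := by positivity
  refine ⟨(K ^ 2 + 1) * κ * 2 * C, by positivity, fun t => ?_⟩
  obtain ⟨hs, hle⟩ := hsum _ (one_le_anisoGauge (q2 := q2) (q3 := q3) h1 t)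
  set h : ℤ × ℤ × ℤ → ℝ := fun s =>
    (anisoGauge q1 q2 q3 s * max (anisoGauge q1 q2 q3 s) (anisoGauge q1 q2 q3 t))⁻¹ with hh
  have hs' : HasSum (fun s => h (t + s)) (∑' s, h s) :=
    ((Equiv.addLeft t).hasSum_iff (f := h)).2 hs.hasSum
  have hH := ((hs.hasSum.add hs').mul_left κ).mul_left (K ^ 2)
  have hb : ∀ s, ‖a s * a (t + s)‖ ≤ K ^ 2 * (κ * (h s + h (t + s))) := by
    intro s
    rw [Real.norm_eq_abs, abs_mul]
    calc |a s| * |a (t + s)| ≤ (K * (anisoGauge q1 q2 q3 s)⁻¹) *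
          (K * (anisoGauge q1 q2 q3 (t + s))⁻¹) :=
          mul_le_mul (hK s) (hK _) (abs_nonneg _) ((abs_nonneg _).trans (hK s))
      _ = K ^ 2 * (anisoGauge q1 q2 q3 s * anisoGauge q1 q2 q3 (t + s))⁻¹ := by
        rw [mul_inv]; ring
      _ ≤ _ := mul_le_mul_of_nonneg_left (inv_anisoGauge_mul_le h1 h2 h3 s t) (sq_nonneg K)
  have hsm := Summable.of_norm_bounded hH.summable hb
  refine ⟨hsm, ?_⟩
  have := tsum_of_norm_bounded hH hb
  rw [Real.norm_eq_abs] at this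
  refine this.trans ?_
  have hX : ∀ u, 0 < anisoGauge q1 q2 q3 u := fun u => one_pos.trans_le (one_le_anisoGauge h1 u)
  have h0 : 0 ≤ ∑' s, h s := tsum_nonneg fun s => by
    have := hX s
    positivity
  calc _ = K ^ 2 * κ * 2 * ∑' s, h s := by ring
    _ ≤ (K ^ 2 + 1) * κ * 2 *
        (C * anisoGauge q1 q2 q3 t ^ ((1 / q1 + 1 / q2 + 1 / q3) - 2)) := by
      refine mul_le_mul ?_ hle h0 (by positivity)
      gcongr
      linarith
    _ = _ := by ring

theorem hasSum_finset_indicator_one {ι : Type*} [DecidableEq ι] (F : Finset ι) :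
    HasSum (fun s => if s ∈ F then (1 : ℝ) else 0) F.card := by
  have : HasSum (fun s => if s ∈ F then (1 : ℝ) else 0)
      (∑ s ∈ F, if s ∈ F then (1 : ℝ) else 0) :=
    hasSum_sum_of_ne_finset_zero fun b hb => by simp [hb]
  simpa using this

theorem eventually_le_tsum_mul_shift (h1 : 0 < q1) (h2 : 0 < q2) (h3 : 0 < q3)
    (hQ1 : 1 < 1 / q1 + 1 / q2 + 1 / q3) {a : ℤ × ℤ × ℤ → ℝ} {K k : ℝ}
    (hK : ∀ s, |a s| ≤ K * (anisoGauge q1 q2 q3 s)⁻¹) (hk : 0 < k) (F : Finset (ℤ × ℤ × ℤ))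
    (hF : ∀ s ∉ F, k * (anisoGauge q1 q2 q3 s)⁻¹ ≤ a s)
    (hsm : ∀ t, Summable (fun s => a s * a (t + s))) :
    ∃ c : ℝ, 0 < c ∧ ∀ᶠ t in cofinite,
      c * anisoGauge q1 q2 q3 t ^ ((1 / q1 + 1 / q2 + 1 / q3) - 2) ≤ ∑' s, a s * a (t + s) := by
  set κ : ℝ := 2 ^ (q1 + q2 + q3) with hκ
  have hκ1 : 1 ≤ κ := Real.one_le_rpow (by norm_num) (by linarith)
  have hκ0 : 0 < κ := by linarith
  obtain ⟨Q, hQ⟩ : ∃ Q, Q = 1 / q1 + 1 / q2 + 1 / q3 := ⟨_, rfl⟩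
  rw [← hQ] at hQ1 ⊢
  set D : ℝ := K ^ 2 * κ + k ^ 2 with hD
  have hD0 : 0 < D := by positivity
  have hev := ((tendsto_rpow_atTop (by linarith : 0 < Q - 1)).comp
    (tendsto_anisoGauge h1 h2 h3)).eventually_ge_atTop (4 * D * F.card * κ / k ^ 2)
  refine ⟨k ^ 2 / (2 * κ), by positivity, hev.mono fun t ht => ?_⟩
  simp only [Function.comp] at ht
  have hN1 := one_le_anisoGauge (q2 := q2) (q3 := q3) h1 t
  obtain ⟨B, hBcard, hB⟩ := exists_finset_anisoGauge_le h1 h2 h3 hN1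
  rw [← hQ] at hBcard
  have hpt : ∀ s, k ^ 2 / (κ * anisoGauge q1 q2 q3 t ^ 2) * (if s ∈ B then (1 : ℝ) else 0) ≤
      a s * a (t + s) + D / anisoGauge q1 q2 q3 t *
        ((if s ∈ F then (1 : ℝ) else 0) + (if t + s ∈ F then (1 : ℝ) else 0)) := by
    intro s
    have hx := one_le_anisoGauge (q2 := q2) (q3 := q3) h1 s
    have hy := one_le_anisoGauge (q2 := q2) (q3 := q3) h1 (t + s)
    have hKs := hK s
    have hKt := hK (t + s)
    have hinv := inv_anisoGauge_mul_le_inv h1 h2 h3 s t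
    have hBs : s ∈ B → anisoGauge q1 q2 q3 s ≤ anisoGauge q1 q2 q3 t ∧
        anisoGauge q1 q2 q3 (t + s) ≤ κ * anisoGauge q1 q2 q3 t := fun h =>
      ⟨hB s h, anisoGauge_add_le h1 h2 h3 s t (hB s h) le_rfl⟩
    have hFs := hF s
    have hFt := hF (t + s)
    clear hB hBcard ht hev hF hK
    generalize anisoGauge q1 q2 q3 t = N at *
    generalize anisoGauge q1 q2 q3 s = x at *
    generalize anisoGauge q1 q2 q3 (t + s) = y at *
    have hN0 : 0 < N := by linarith
    have hbad : k ^ 2 / (κ * N ^ 2) * (if s ∈ B then (1 : ℝ) else 0) ≤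
        a s * a (t + s) + D / N := by
      have e1 : k ^ 2 / (κ * N ^ 2) * (if s ∈ B then (1 : ℝ) else 0) ≤ k ^ 2 / N := by
        have : k ^ 2 / (κ * N ^ 2) ≤ k ^ 2 / N :=
          div_le_div_of_nonneg_left (by positivity) hN0 (by nlinarith)
        split_ifs
        · linarith
        · rw [mul_zero]; positivity
      have e2 : |a s * a (t + s)| ≤ K ^ 2 * κ / N := by
        rw [abs_mul]
        calc |a s| * |a (t + s)| ≤ (K * x⁻¹) * (K * y⁻¹) :=
              mul_le_mul hKs hKt (abs_nonneg _) ((abs_nonneg _).trans hKs)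
          _ = K ^ 2 * (x * y)⁻¹ := by rw [mul_inv]; ring
          _ ≤ K ^ 2 * (κ * N⁻¹) := mul_le_mul_of_nonneg_left hinv (sq_nonneg K)
          _ = K ^ 2 * κ / N := by ring
      have e3 : D / N = K ^ 2 * κ / N + k ^ 2 / N := by rw [hD, add_div]
      have := (abs_le.1 e2).1
      linarith
    have hDN : 0 ≤ D / N := by positivity
    by_cases hsF : s ∈ F
    · refine hbad.trans ?_
      simp only [hsF, if_true]
      split_ifs <;> linarith
    by_cases htF : t + s ∈ F
    · refine hbad.trans ?_
      simp [hsF, htF]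
    · have hxs := hFs hsF
      have hyt := hFt htF
      have hprod : k ^ 2 / (x * y) ≤ a s * a (t + s) := by
        calc k ^ 2 / (x * y) = (k * x⁻¹) * (k * y⁻¹) := by field_simp
          _ ≤ _ := mul_le_mul hxs hyt (by positivity) (le_trans (by positivity) hxs)
      simp only [hsF, htF, if_false, add_zero, mul_zero]
      split_ifs with hs
      · obtain ⟨b1, b2⟩ := hBs hs
        rw [mul_one]
        refine le_trans ?_ hprod
        refine div_le_div_of_nonneg_left (by positivity) (by positivity) ?_
        calc x * y ≤ N * (κ * N) := by gcongr
          _ = κ * N ^ 2 := by ring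
      · rw [mul_zero]
        exact le_trans (by positivity) hprod
  have hFsum := hasSum_finset_indicator_one F
  have hFsum' : HasSum (fun s => if t + s ∈ F then (1 : ℝ) else 0) F.card :=
    ((Equiv.addLeft t).hasSum_iff (f := fun s => if s ∈ F then (1 : ℝ) else 0)).2 hFsum
  have hfin := hasSum_le hpt ((hasSum_finset_indicator_one B).mul_left _)
    ((hsm t).hasSum.add ((hFsum.add hFsum').mul_left _))
  clear hpt hB hFsum hFsum'
  generalize ∑' s, a s * a (t + s) = r at *
  generalize anisoGauge q1 q2 q3 t = N at *
  have hN0 : 0 < N := by linarith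
  have g1 : k ^ 2 / (κ * N ^ 2) * N ^ Q ≤ k ^ 2 / (κ * N ^ 2) * B.card := by gcongr
  have g2 : N ^ Q = N ^ (Q - 1) * N := by
    rw [← Real.rpow_add_one hN0.ne']; ring_nf
  have g3 : N ^ (Q - 2) = N ^ (Q - 1) / N := by
    rw [← Real.rpow_sub_one hN0.ne']; ring_nf
  have g4 : D * F.card ≤ k ^ 2 * N ^ (Q - 1) / (4 * κ) := by
    rw [div_le_iff₀ (by positivity)] at ht
    rw [le_div_iff₀ (by positivity)]
    linarith
  have g5 : k ^ 2 / (κ * N ^ 2) * N ^ Q = 4 * (k ^ 2 * N ^ (Q - 1) / (4 * κ)) / N := by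
    rw [g2]; field_simp
  have g6 : k ^ 2 / (2 * κ) * N ^ (Q - 2) = 2 * (k ^ 2 * N ^ (Q - 1) / (4 * κ)) / N := by
    rw [g3]; field_simp; norm_num
  have g7 : D / N * (F.card + F.card) = 2 * (D * F.card) / N := by ring
  rw [g6]
  rw [g5] at g1
  rw [g7] at hfin
  have g8 : 2 * (D * F.card) / N ≤ 2 * (k ^ 2 * N ^ (Q - 1) / (4 * κ)) / N := by gcongr
  have g9 : 4 * (k ^ 2 * N ^ (Q - 1) / (4 * κ)) / N =
      2 * (k ^ 2 * N ^ (Q - 1) / (4 * κ)) / N + 2 * (k ^ 2 * N ^ (Q - 1) / (4 * κ)) / N := by ring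
  linarith

end Autocovariance

section Weight

variable {q1 q2 q3 : ℝ}

theorem anisoGauge_le_sum_rpow_and_le (h1 : 0 < q1) (h2 : 0 < q2) (h3 : 0 < q3)
    {t : ℤ × ℤ × ℤ} (ht : t ≠ 0) :
    anisoGauge q1 q2 q3 t ≤ |(t.1 : ℝ)| ^ q1 + |(t.2.1 : ℝ)| ^ q2 + |(t.2.2 : ℝ)| ^ q3 ∧
      |(t.1 : ℝ)| ^ q1 + |(t.2.1 : ℝ)| ^ q2 + |(t.2.2 : ℝ)| ^ q3 ≤
        3 * anisoGauge q1 q2 q3 t := by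
  have hup : ∀ (q : ℝ) (n : ℤ), 0 < q → |(n : ℝ)| ^ q ≤ truncAbs n ^ q := fun q n hq =>
    Real.rpow_le_rpow (abs_nonneg _) (le_max_left _ _) hq.le
  have hnn : ∀ (q : ℝ) (n : ℤ), 0 ≤ |(n : ℝ)| ^ q := fun q n => by positivity
  have heq : ∀ (q : ℝ) (n : ℤ), 0 < q → n ≠ 0 →
      truncAbs n ^ q = |(n : ℝ)| ^ q ∧ 1 ≤ |(n : ℝ)| ^ q := by
    intro q n hq hn
    have : (1 : ℝ) ≤ |(n : ℝ)| := by exact_mod_cast Int.one_le_abs hn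
    exact ⟨by rw [truncAbs, max_eq_left this], Real.one_le_rpow this hq.le⟩
  have hzero : ∀ q : ℝ, truncAbs 0 ^ q = 1 := fun q => by simp [truncAbs]
  obtain ⟨l1, l2, l3⟩ := anisoGauge_le_iff.1 (le_refl (anisoGauge q1 q2 q3 t))
  have n1 := hnn q1 t.1
  have n2 := hnn q2 t.2.1
  have n3 := hnn q3 t.2.2
  refine ⟨?_, by linarith [hup q1 t.1 h1, hup q2 t.2.1 h2, hup q3 t.2.2 h3]⟩
  have hone : 1 ≤ |(t.1 : ℝ)| ^ q1 + |(t.2.1 : ℝ)| ^ q2 + |(t.2.2 : ℝ)| ^ q3 := by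
    by_cases z1 : t.1 = 0
    · by_cases z2 : t.2.1 = 0
      · have z3 : t.2.2 ≠ 0 := fun z3 => ht (Prod.ext z1 (Prod.ext z2 z3))
        linarith [(heq q3 _ h3 z3).2]
      · linarith [(heq q2 _ h2 z2).2]
    · linarith [(heq q1 _ h1 z1).2]
  have hcomp : ∀ (q : ℝ) (n : ℤ), 0 < q →
      |(n : ℝ)| ^ q ≤ |(t.1 : ℝ)| ^ q1 + |(t.2.1 : ℝ)| ^ q2 + |(t.2.2 : ℝ)| ^ q3 →
      truncAbs n ^ q ≤ |(t.1 : ℝ)| ^ q1 + |(t.2.1 : ℝ)| ^ q2 + |(t.2.2 : ℝ)| ^ q3 := by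
    intro q n hq hn
    by_cases z : n = 0
    · rwa [z, hzero]
    · rwa [(heq q n hq z).1]
  exact anisoGauge_le_iff.2 ⟨hcomp q1 _ h1 (by linarith), hcomp q2 _ h2 (by linarith),
    hcomp q3 _ h3 (by linarith)⟩

theorem weighted_sum_rpow_bounds {c1 c2 c3 ν : ℝ} (hc1 : 0 < c1) (hc2 : 0 < c2) (hc3 : 0 < c3)
    (hν : 0 < ν) (t : ℤ × ℤ × ℤ) :
    min c1 (min c2 c3) ^ ν * anisoGauge q1 q2 q3 t ≤
      (c1 * truncAbs t.1 ^ (q1 / ν) + c2 * truncAbs t.2.1 ^ (q2 / ν) +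
        c3 * truncAbs t.2.2 ^ (q3 / ν)) ^ ν ∧
    (c1 * truncAbs t.1 ^ (q1 / ν) + c2 * truncAbs t.2.1 ^ (q2 / ν) +
        c3 * truncAbs t.2.2 ^ (q3 / ν)) ^ ν ≤ (c1 + c2 + c3) ^ ν * anisoGauge q1 q2 q3 t := by
  have p1 := truncAbs_pos t.1
  have p2 := truncAbs_pos t.2.1
  have p3 := truncAbs_pos t.2.2
  set m := min c1 (min c2 c3) with hm
  have hm0 : 0 < m := lt_min hc1 (lt_min hc2 hc3)
  have m1 : m ≤ c1 := min_le_left _ _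
  have m2 : m ≤ c2 := (min_le_right _ _).trans (min_le_left _ _)
  have m3 : m ≤ c3 := (min_le_right _ _).trans (min_le_right _ _)
  have hpow : ∀ (q x : ℝ), 0 < x → (x ^ (q / ν)) ^ ν = x ^ q := fun q x hx => by
    rw [← Real.rpow_mul hx.le]; field_simp
  constructor
  · have hmν : 0 < m ^ ν := by positivity
    rw [mul_comm, ← le_div_iff₀ hmν, anisoGauge_le_iff]
    have key : ∀ (q x S : ℝ), 0 < x → m * x ^ (q / ν) ≤ S → x ^ q ≤ S ^ ν / m ^ ν := by
      intro q x S hx hS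
      rw [le_div_iff₀ hmν, mul_comm, ← hpow q x hx, ← Real.mul_rpow hm0.le (by positivity)]
      exact Real.rpow_le_rpow (by positivity) hS hν.le
    have a1 : 0 < truncAbs t.1 ^ (q1 / ν) := by positivity
    have a2 : 0 < truncAbs t.2.1 ^ (q2 / ν) := by positivity
    have a3 : 0 < truncAbs t.2.2 ^ (q3 / ν) := by positivity
    have b1 := mul_le_mul_of_nonneg_right m1 a1.le
    have b2 := mul_le_mul_of_nonneg_right m2 a2.le
    have b3 := mul_le_mul_of_nonneg_right m3 a3.le
    have d1 := mul_pos hm0 a1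
    have d2 := mul_pos hm0 a2
    have d3 := mul_pos hm0 a3
    exact ⟨key _ _ _ p1 (by linarith), key _ _ _ p2 (by linarith), key _ _ _ p3 (by linarith)⟩
  · obtain ⟨l1, l2, l3⟩ := anisoGauge_le_iff.1 (le_refl (anisoGauge q1 q2 q3 t))
    have hX : 0 < anisoGauge q1 q2 q3 t := (Real.rpow_pos_of_pos p1 q1).trans_le l1
    generalize anisoGauge q1 q2 q3 t = X at *
    have key : ∀ (q x : ℝ), 0 < x → x ^ q ≤ X → x ^ (q / ν) ≤ X ^ (1 / ν) := fun q x hx hle =>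
      le_rpow_one_div hν (by positivity) (by rwa [hpow q x hx])
    have k1 := key _ _ p1 l1
    have k2 := key _ _ p2 l2
    have k3 := key _ _ p3 l3
    calc _ ≤ (c1 * X ^ (1 / ν) + c2 * X ^ (1 / ν) + c3 * X ^ (1 / ν)) ^ ν := by gcongr
      _ = ((c1 + c2 + c3) * X ^ (1 / ν)) ^ ν := by ring_nf
      _ = _ := by
        rw [Real.mul_rpow (by positivity) (by positivity), one_div,
          Real.rpow_inv_rpow hX.le hν.ne']

end Weight

theorem stmt_8 (q1 q2 q3 c1 c2 c3 ν : ℝ)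
    (hq1 : 0 < q1) (hq2 : 0 < q2) (hq3 : 0 < q3)
    (hc1 : 0 < c1) (hc2 : 0 < c2) (hc3 : 0 < c3) (hν : 0 < ν)
    (g : ℤ × ℤ × ℤ → ℝ) (hg : ∃ M : ℝ, ∀ t, |g t| ≤ M)
    (hg1 : Tendsto g cofinite (nhds 1))
    (a : ℤ × ℤ × ℤ → ℝ)
    (ha : ∀ t : ℤ × ℤ × ℤ, a t = g t /
      (c1 * (max |(t.1 : ℝ)| 1) ^ (q1 / ν) + c2 * (max |(t.2.1 : ℝ)| 1) ^ (q2 / ν) +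
        c3 * (max |(t.2.2 : ℝ)| 1) ^ (q3 / ν)) ^ ν)
    (hQlow : 1 < 1 / q1 + 1 / q2 + 1 / q3)
    (hQup : 1 / q1 + 1 / q2 + 1 / q3 < 2)
    (r : ℤ × ℤ × ℤ → ℝ)
    (hr : ∀ t : ℤ × ℤ × ℤ, r t = ∑' s : ℤ × ℤ × ℤ, a s * a (t + s)) :
    ∃ C1 C2 : ℝ, 0 < C1 ∧ C1 ≤ C2 ∧
      C1 ≤ liminf (fun t : ℤ × ℤ × ℤ =>
          (|(t.1 : ℝ)| ^ q1 + |(t.2.1 : ℝ)| ^ q2 + |(t.2.2 : ℝ)| ^ q3) ^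
              (2 - (1 / q1 + 1 / q2 + 1 / q3)) * |r t|) cofinite ∧
      limsup (fun t : ℤ × ℤ × ℤ =>
          (|(t.1 : ℝ)| ^ q1 + |(t.2.1 : ℝ)| ^ q2 + |(t.2.2 : ℝ)| ^ q3) ^
              (2 - (1 / q1 + 1 / q2 + 1 / q3)) * |r t|) cofinite ≤ C2 := by
  obtain ⟨M, hM⟩ := hg
  have hM0 : 0 ≤ M := (abs_nonneg _).trans (hM 0)
  set m : ℝ := min c1 (min c2 c3) ^ ν with hm
  have hm0 : 0 < m := Real.rpow_pos_of_pos (lt_min hc1 (lt_min hc2 hc3)) ν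
  set w : ℝ := (c1 + c2 + c3) ^ ν with hw
  have hw0 : 0 < w := by positivity
  have hX : ∀ t, 0 < anisoGauge q1 q2 q3 t := fun t =>
    one_pos.trans_le (one_le_anisoGauge hq1 t)
  have hK : ∀ s, |a s| ≤ M / m * (anisoGauge q1 q2 q3 s)⁻¹ := by
    intro s
    have has := ha s
    simp only [← truncAbs.eq_1] at has
    have hb := (weighted_sum_rpow_bounds (q1 := q1) (q2 := q2) (q3 := q3) hc1 hc2 hc3 hν s).1
    have hXs := mul_pos hm0 (hX s)
    rw [has, abs_div, abs_of_pos (hXs.trans_le hb), ← div_eq_mul_inv, div_div]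
    exact div_le_div₀ hM0 (hM s) hXs hb
  have hfin : {s | ¬ 1 / 2 < g s}.Finite := hg1.eventually (lt_mem_nhds (by norm_num))
  have hF : ∀ s ∉ hfin.toFinset, 1 / 2 / w * (anisoGauge q1 q2 q3 s)⁻¹ ≤ a s := by
    intro s hs
    have hs : 1 / 2 < g s := by simpa using hs
    have has := ha s
    simp only [← truncAbs.eq_1] at has
    have hb := weighted_sum_rpow_bounds (q1 := q1) (q2 := q2) (q3 := q3) hc1 hc2 hc3 hν s
    have hXs := mul_pos hm0 (hX s)
    rw [has, ← div_eq_mul_inv, div_div]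
    exact div_le_div₀ (by linarith) hs.le (hXs.trans_le hb.1) hb.2
  obtain ⟨C, hC, hup⟩ := summable_and_abs_tsum_mul_shift_le hq1 hq2 hq3 hQlow hQup hK
  obtain ⟨c, hc, hlow⟩ := eventually_le_tsum_mul_shift hq1 hq2 hq3 hQlow hK (by positivity)
    hfin.toFinset hF (fun t => (hup t).1)
  obtain ⟨Q, hQ⟩ : ∃ Q, Q = 1 / q1 + 1 / q2 + 1 / q3 := ⟨_, rfl⟩
  rw [← hQ] at hQup hup hlow ⊢
  have hcancel : ∀ t, anisoGauge q1 q2 q3 t ^ (2 - Q) * anisoGauge q1 q2 q3 t ^ (Q - 2) = 1 :=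
    fun t => by rw [← Real.rpow_add (hX t)]; simp
  have hne : ∀ᶠ t : ℤ × ℤ × ℤ in cofinite, t ≠ 0 := by
    simp
  have hlow' : ∀ᶠ t : ℤ × ℤ × ℤ in cofinite,
      c ≤ (|(t.1 : ℝ)| ^ q1 + |(t.2.1 : ℝ)| ^ q2 + |(t.2.2 : ℝ)| ^ q3) ^ (2 - Q) * |r t| := by
    filter_upwards [hlow, hne] with t ht h0
    have hρ := (anisoGauge_le_sum_rpow_and_le hq1 hq2 hq3 h0).1
    rw [← hr t] at ht
    calc c = anisoGauge q1 q2 q3 t ^ (2 - Q) * (c * anisoGauge q1 q2 q3 t ^ (Q - 2)) := by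
          rw [mul_left_comm, hcancel, mul_one]
      _ ≤ _ := mul_le_mul (Real.rpow_le_rpow (hX t).le hρ (by linarith))
          (ht.trans (le_abs_self _)) (by have := hX t; positivity) (by positivity)
  have hup' : ∀ᶠ t : ℤ × ℤ × ℤ in cofinite,
      (|(t.1 : ℝ)| ^ q1 + |(t.2.1 : ℝ)| ^ q2 + |(t.2.2 : ℝ)| ^ q3) ^ (2 - Q) * |r t| ≤
        3 ^ (2 - Q) * C := by
    filter_upwards [hne] with t h0
    have hρ := (anisoGauge_le_sum_rpow_and_le hq1 hq2 hq3 h0).2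
    have ht := (hup t).2
    rw [← hr t] at ht
    have hXt := hX t
    calc _ ≤ (3 * anisoGauge q1 q2 q3 t) ^ (2 - Q) * (C * anisoGauge q1 q2 q3 t ^ (Q - 2)) :=
          mul_le_mul (Real.rpow_le_rpow (by positivity) hρ (by linarith)) ht
            (abs_nonneg _) (by positivity)
      _ = 3 ^ (2 - Q) * C *
          (anisoGauge q1 q2 q3 t ^ (2 - Q) * anisoGauge q1 q2 q3 t ^ (Q - 2)) := by
          rw [Real.mul_rpow (by norm_num) hXt.le]; ring
      _ = _ := by rw [hcancel, mul_one]
  obtain ⟨t, ht1, ht2⟩ := (hlow'.and hup').exists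
  exact ⟨c, 3 ^ (2 - Q) * C, hc, ht1.trans ht2,
    le_liminf_of_le (IsBoundedUnder.isCoboundedUnder_ge ⟨_, hup'⟩) hlow',
    limsup_le_of_le (IsBoundedUnder.isCoboundedUnder_le ⟨_, hlow'⟩) hup'⟩
end

section
/- Assume additionally 1/(2q1) + 1/q2 + 1/q3 < 1 (Region I). Then Σ_{(t1,t2,t3)∈ℤ³} |r(t1,t2,t3)| = ∞ while Σ_{(t2,t3)∈ℤ²} |r(0,t2,t3)| < ∞. -/
open Filter

/-- The absolute value of an integer, cut off from below at `1`. -/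
noncomputable def clampAbs (x : ℤ) : ℝ := max |(x : ℝ)| 1

theorem one_le_clampAbs (x : ℤ) : 1 ≤ clampAbs x := le_max_right _ _

theorem clampAbs_pos (x : ℤ) : 0 < clampAbs x := one_pos.trans_le (one_le_clampAbs x)

theorem clampAbs_neg (x : ℤ) : clampAbs (-x) = clampAbs x := by simp [clampAbs]

theorem tendsto_clampAbs : Tendsto clampAbs cofinite atTop := by
  have h : Tendsto (fun x : ℤ => ‖x‖) cofinite atTop := by
    rw [← cocompact_eq_cofinite ℤ]
    exact tendsto_norm_cocompact_atTop
  refine tendsto_atTop_mono (fun x => ?_) h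
  rw [Int.norm_eq_abs]
  exact le_max_left _ _

theorem tendsto_clampAbs_add_div (s : ℤ) :
    Tendsto (fun x => clampAbs (x + s) / clampAbs x) cofinite (nhds 1) := by
  have h0 : Tendsto (fun x => |(s : ℝ)| / clampAbs x) cofinite (nhds 0) :=
    tendsto_clampAbs.const_div_atTop _
  have h1 : Tendsto (fun x => clampAbs (x + s) / clampAbs x - 1) cofinite (nhds 0) := by
    refine squeeze_zero_norm (fun x => ?_) h0
    have hx := clampAbs_pos x
    rw [div_sub_one hx.ne', norm_div, Real.norm_eq_abs, Real.norm_eq_abs, abs_of_pos hx]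
    refine div_le_div_of_nonneg_right ?_ hx.le
    calc |clampAbs (x + s) - clampAbs x| ≤ |(|((x + s : ℤ) : ℝ)| - |(x : ℝ)|)| :=
          abs_max_sub_max_le_abs _ _ _
      _ ≤ |((x + s : ℤ) : ℝ) - x| := abs_abs_sub_abs_le _ _
      _ = |(s : ℝ)| := by simp
  simpa using h1.add_const 1

theorem exists_abs_clampAbs_add_rpow_sub_le (β : ℝ) (s : ℤ) {ε : ℝ} (hε : 0 < ε) :
    ∃ C, ∀ x, |clampAbs (x + s) ^ β - clampAbs x ^ β| ≤ ε * clampAbs x ^ β + C := by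
  have h : Tendsto (fun x => clampAbs (x + s) ^ β / clampAbs x ^ β) cofinite (nhds 1) := by
    have h := (tendsto_clampAbs_add_div s).rpow_const (p := β) (Or.inl one_ne_zero)
    rw [Real.one_rpow] at h
    exact h.congr fun x => Real.div_rpow (clampAbs_pos _).le (clampAbs_pos _).le _
  have hev := h.eventually (Metric.ball_mem_nhds 1 hε)
  obtain ⟨C, hC⟩ := ((eventually_cofinite.1 hev).image
    fun x => |clampAbs (x + s) ^ β - clampAbs x ^ β|).bddAbove
  refine ⟨max C 0, fun x => ?_⟩
  have hx : 0 < clampAbs x ^ β := Real.rpow_pos_of_pos (clampAbs_pos x) β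
  by_cases hx' : clampAbs (x + s) ^ β / clampAbs x ^ β ∈ Metric.ball 1 ε
  · rw [Metric.mem_ball, Real.dist_eq, div_sub_one hx.ne', abs_div, abs_of_pos hx,
      div_lt_iff₀ hx] at hx'
    linarith [le_max_right C 0]
  · have h1 := hC (Set.mem_image_of_mem _ hx')
    have h2 : 0 ≤ ε * clampAbs x ^ β := by positivity
    exact h1.trans ((le_max_left C 0).trans (by linarith))

theorem summable_clampAbs_rpow_neg {α : ℝ} (hα : 1 < α) :
    Summable fun x => clampAbs x ^ (-α) := by
  refine Summable.of_norm_bounded_eventually (Real.summable_abs_int_rpow hα) ?_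
  filter_upwards [(Set.finite_singleton (0 : ℤ)).eventually_cofinite_notMem] with x hx
  have h1 : (1 : ℝ) ≤ |(x : ℝ)| := by exact_mod_cast Int.one_le_abs hx
  rw [Real.norm_of_nonneg (Real.rpow_nonneg (clampAbs_pos x).le _), clampAbs, max_eq_left h1]

/-- The increments of a power of `clampAbs` along a projection are negligible against any
function dominating that power. -/
theorem isLittleO_clampAbs_add_rpow_sub {G : Type*} {l : Filter G} {E : G → ℝ} (π : G → ℤ)
    {c β : ℝ} (hc : 0 < c) (s : ℤ) (hE : Tendsto E l atTop)
    (hle : ∀ t, c * clampAbs (π t) ^ β ≤ E t) :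
    (fun t => c * clampAbs (π t + s) ^ β - c * clampAbs (π t) ^ β) =o[l] E := by
  rw [Asymptotics.isLittleO_iff]
  intro ε hε
  obtain ⟨C, hC⟩ := exists_abs_clampAbs_add_rpow_sub_le β s (half_pos hε)
  filter_upwards [hE.eventually_ge_atTop (c * C / (ε / 2))] with t ht
  rw [div_le_iff₀ (half_pos hε)] at ht
  have h1 := hle t
  have h2 := mul_le_mul_of_nonneg_left (hC (π t)) hc.le
  have h3 : 0 ≤ c * clampAbs (π t) ^ β :=
    mul_nonneg hc.le (Real.rpow_nonneg (clampAbs_pos _).le _)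
  rw [← mul_sub, norm_mul, Real.norm_of_nonneg hc.le, Real.norm_of_nonneg (h3.trans h1),
    Real.norm_eq_abs]
  nlinarith [mul_le_mul_of_nonneg_left h1 (half_pos hε).le]

/-- The anisotropic gauge `c₁ |t₁|₊ ^ β₁ + c₂ |t₂|₊ ^ β₂ + c₃ |t₃|₊ ^ β₃` on `ℤ³`. -/
noncomputable def gauge₃ (c₁ c₂ c₃ β₁ β₂ β₃ : ℝ) (t : ℤ × ℤ × ℤ) : ℝ :=
  c₁ * clampAbs t.1 ^ β₁ + c₂ * clampAbs t.2.1 ^ β₂ + c₃ * clampAbs t.2.2 ^ β₃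

section Gauge

variable {c₁ c₂ c₃ β₁ β₂ β₃ : ℝ}

theorem mul_clampAbs_rpow_pos {c : ℝ} (hc : 0 < c) (β : ℝ) (x : ℤ) : 0 < c * clampAbs x ^ β :=
  mul_pos hc (Real.rpow_pos_of_pos (clampAbs_pos x) β)

theorem gauge₃_neg (t : ℤ × ℤ × ℤ) :
    gauge₃ c₁ c₂ c₃ β₁ β₂ β₃ (-t) = gauge₃ c₁ c₂ c₃ β₁ β₂ β₃ t := by
  simp [gauge₃, clampAbs_neg]

theorem fst_le_gauge₃ (h₂ : 0 < c₂) (h₃ : 0 < c₃) (t : ℤ × ℤ × ℤ) :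
    c₁ * clampAbs t.1 ^ β₁ ≤ gauge₃ c₁ c₂ c₃ β₁ β₂ β₃ t := by
  have := mul_clampAbs_rpow_pos h₂ β₂ t.2.1
  have := mul_clampAbs_rpow_pos h₃ β₃ t.2.2
  unfold gauge₃; linarith

theorem snd_le_gauge₃ (h₁ : 0 < c₁) (h₃ : 0 < c₃) (t : ℤ × ℤ × ℤ) :
    c₂ * clampAbs t.2.1 ^ β₂ ≤ gauge₃ c₁ c₂ c₃ β₁ β₂ β₃ t := by
  have := mul_clampAbs_rpow_pos h₁ β₁ t.1
  have := mul_clampAbs_rpow_pos h₃ β₃ t.2.2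
  unfold gauge₃; linarith

theorem thd_le_gauge₃ (h₁ : 0 < c₁) (h₂ : 0 < c₂) (t : ℤ × ℤ × ℤ) :
    c₃ * clampAbs t.2.2 ^ β₃ ≤ gauge₃ c₁ c₂ c₃ β₁ β₂ β₃ t := by
  have := mul_clampAbs_rpow_pos h₁ β₁ t.1
  have := mul_clampAbs_rpow_pos h₂ β₂ t.2.1
  unfold gauge₃; linarith

theorem gauge₃_pos (h₁ : 0 < c₁) (h₂ : 0 < c₂) (h₃ : 0 < c₃) (t : ℤ × ℤ × ℤ) :
    0 < gauge₃ c₁ c₂ c₃ β₁ β₂ β₃ t :=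
  (mul_clampAbs_rpow_pos h₁ β₁ t.1).trans_le (fst_le_gauge₃ h₂ h₃ t)

theorem tendsto_gauge₃ (h₁ : 0 < c₁) (h₂ : 0 < c₂) (h₃ : 0 < c₃)
    (hβ₁ : 0 < β₁) (hβ₂ : 0 < β₂) (hβ₃ : 0 < β₃) :
    Tendsto (gauge₃ c₁ c₂ c₃ β₁ β₂ β₃) cofinite atTop := by
  have key : ∀ {c β : ℝ}, 0 < c → 0 < β →
      Tendsto (fun x => c * clampAbs x ^ β) cofinite atTop := fun hc hβ =>
    ((tendsto_rpow_atTop hβ).comp tendsto_clampAbs).const_mul_atTop hc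
  rw [← coprod_cofinite, ← coprod_cofinite, Filter.coprod, Filter.coprod, comap_sup,
    tendsto_sup, tendsto_sup]
  refine ⟨?_, ?_, ?_⟩
  · exact tendsto_atTop_mono (fst_le_gauge₃ h₂ h₃) ((key h₁ hβ₁).comp tendsto_comap)
  · exact tendsto_atTop_mono (snd_le_gauge₃ h₁ h₃)
      ((key h₂ hβ₂).comp (tendsto_comap.comp tendsto_comap))
  · exact tendsto_atTop_mono (thd_le_gauge₃ h₁ h₂)
      ((key h₃ hβ₃).comp (tendsto_comap.comp tendsto_comap))

theorem tendsto_gauge₃_add_div (h₁ : 0 < c₁) (h₂ : 0 < c₂) (h₃ : 0 < c₃)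
    (hβ₁ : 0 < β₁) (hβ₂ : 0 < β₂) (hβ₃ : 0 < β₃) (s : ℤ × ℤ × ℤ) :
    Tendsto (fun t => gauge₃ c₁ c₂ c₃ β₁ β₂ β₃ (t + s) / gauge₃ c₁ c₂ c₃ β₁ β₂ β₃ t)
      cofinite (nhds 1) := by
  have hE := tendsto_gauge₃ h₁ h₂ h₃ hβ₁ hβ₂ hβ₃
  have h := ((isLittleO_clampAbs_add_rpow_sub (fun t : ℤ × ℤ × ℤ => t.1) h₁ s.1 hE
    (fst_le_gauge₃ h₂ h₃)).add
    (isLittleO_clampAbs_add_rpow_sub (fun t : ℤ × ℤ × ℤ => t.2.1) h₂ s.2.1 hE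
    (snd_le_gauge₃ h₁ h₃))).add
    (isLittleO_clampAbs_add_rpow_sub (fun t : ℤ × ℤ × ℤ => t.2.2) h₃ s.2.2 hE
    (thd_le_gauge₃ h₁ h₂))
  have h' := h.tendsto_div_nhds_zero.add_const 1
  rw [zero_add] at h'
  refine h'.congr fun t => ?_
  rw [div_add_one (gauge₃_pos h₁ h₂ h₃ t).ne']
  congr 1
  simp only [gauge₃, Prod.fst_add, Prod.snd_add]
  ring

/-- The gauge to the power `ν` dominates a product of powers of the coordinates. -/
theorem exists_prod_rpow_le_gauge₃_rpow (h₁ : 0 < c₁) (h₂ : 0 < c₂) (h₃ : 0 < c₃)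
    {ν w₁ w₂ w₃ : ℝ} (hν : 0 < ν) (hw₁ : 0 ≤ w₁) (hw₂ : 0 ≤ w₂) (hw₃ : 0 ≤ w₃)
    (hw : w₁ + w₂ + w₃ = 1) :
    ∃ K > 0, ∀ t : ℤ × ℤ × ℤ, K * (clampAbs t.1 ^ (β₁ * ν * w₁) *
      (clampAbs t.2.1 ^ (β₂ * ν * w₂) * clampAbs t.2.2 ^ (β₃ * ν * w₃))) ≤
        gauge₃ c₁ c₂ c₃ β₁ β₂ β₃ t ^ ν := by
  refine ⟨c₁ ^ (ν * w₁) * (c₂ ^ (ν * w₂) * c₃ ^ (ν * w₃)), by positivity, fun t => ?_⟩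
  have hE := gauge₃_pos (β₁ := β₁) (β₂ := β₂) (β₃ := β₃) h₁ h₂ h₃ t
  have key : ∀ {c β w : ℝ} {x : ℤ}, 0 < c → 0 ≤ w →
      c * clampAbs x ^ β ≤ gauge₃ c₁ c₂ c₃ β₁ β₂ β₃ t →
      c ^ (ν * w) * clampAbs x ^ (β * ν * w) ≤ gauge₃ c₁ c₂ c₃ β₁ β₂ β₃ t ^ (ν * w) := by
    intro c β w x hc hw h
    have hx := clampAbs_pos x
    rw [mul_assoc, Real.rpow_mul hx.le, ← Real.mul_rpow hc.le (Real.rpow_nonneg hx.le _)]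
    exact Real.rpow_le_rpow (mul_clampAbs_rpow_pos hc β x).le h (by positivity)
  have k₁ := key h₁ hw₁ (fst_le_gauge₃ h₂ h₃ t)
  have k₂ := key h₂ hw₂ (snd_le_gauge₃ h₁ h₃ t)
  have k₃ := key h₃ hw₃ (thd_le_gauge₃ h₁ h₂ t)
  have hpos : ∀ (x : ℤ) (β : ℝ), 0 ≤ clampAbs x ^ β := fun x β =>
    Real.rpow_nonneg (clampAbs_pos x).le β
  have hsplit : gauge₃ c₁ c₂ c₃ β₁ β₂ β₃ t ^ ν = gauge₃ c₁ c₂ c₃ β₁ β₂ β₃ t ^ (ν * w₁) *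
      (gauge₃ c₁ c₂ c₃ β₁ β₂ β₃ t ^ (ν * w₂) * gauge₃ c₁ c₂ c₃ β₁ β₂ β₃ t ^ (ν * w₃)) := by
    rw [← Real.rpow_add hE, ← Real.rpow_add hE, ← mul_add, ← mul_add, ← add_assoc, hw, mul_one]
  rw [hsplit]
  calc _ = c₁ ^ (ν * w₁) * clampAbs t.1 ^ (β₁ * ν * w₁) *
        (c₂ ^ (ν * w₂) * clampAbs t.2.1 ^ (β₂ * ν * w₂) *
        (c₃ ^ (ν * w₃) * clampAbs t.2.2 ^ (β₃ * ν * w₃))) := by ring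
    _ ≤ _ := by
      have := hpos t.1 (β₁ * ν * w₁)
      have := hpos t.2.1 (β₂ * ν * w₂)
      have := hpos t.2.2 (β₃ * ν * w₃)
      gcongr

end Gauge

theorem half_le_natFloor {x : ℝ} (hx : 1 ≤ x) : x / 2 ≤ ⌊x⌋₊ := by
  have h1 := Nat.lt_floor_add_one x
  have h2 : (1 : ℝ) ≤ ⌊x⌋₊ := by exact_mod_cast Nat.one_le_floor_iff x |>.2 hx
  linarith

theorem not_summable_inv_gauge₃_rpow {c₁ c₂ c₃ q₁ q₂ q₃ ν : ℝ} (h₁ : 0 < c₁) (h₂ : 0 < c₂)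
    (h₃ : 0 < c₃) (hq₁ : 0 < q₁) (hq₂ : 0 < q₂) (hq₃ : 0 < q₃) (hν : 0 < ν)
    (hQ : 1 < 1 / q₁ + 1 / q₂ + 1 / q₃) :
    ¬ Summable fun t => (gauge₃ c₁ c₂ c₃ (q₁ / ν) (q₂ / ν) (q₃ / ν) t ^ ν)⁻¹ := by
  intro hsum
  set D := fun t => gauge₃ c₁ c₂ c₃ (q₁ / ν) (q₂ / ν) (q₃ / ν) t ^ ν with hD
  have hDpos : ∀ t, 0 < D t := fun t => Real.rpow_pos_of_pos (gauge₃_pos h₁ h₂ h₃ t) ν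
  set c := c₁ + c₂ + c₃ with hc
  have hc0 : 0 < c := by positivity
  have hbound : ∀ R : ℝ, 1 ≤ R →
      R ^ (1 / q₁ + 1 / q₂ + 1 / q₃ - 1) ≤ 8 * c ^ ν * ∑' t, (D t)⁻¹ := by
    intro R hR
    have hR0 : 0 < R := one_pos.trans_le hR
    let I : ℝ → Finset ℤ := fun q => Finset.Icc 1 (⌊R ^ (1 / q)⌋₊ : ℤ)
    have hroot : ∀ {q : ℝ}, 0 < q → 1 ≤ R ^ (1 / q) := fun hq =>
      Real.one_le_rpow hR (by positivity)
    have hcard : ∀ {q : ℝ}, 0 < q → R ^ (1 / q) / 2 ≤ ((I q).card : ℝ) := by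
      intro q hq
      simpa [I] using half_le_natFloor (hroot hq)
    have hle : ∀ {q : ℝ} {x : ℤ}, 0 < q → x ∈ I q → clampAbs x ^ (q / ν) ≤ R ^ (1 / ν) := by
      intro q x hq hx
      obtain ⟨hx1, hx2⟩ := Finset.mem_Icc.1 hx
      have hx1' : (1 : ℝ) ≤ x := by exact_mod_cast hx1
      have hx2' : (x : ℝ) ≤ ⌊R ^ (1 / q)⌋₊ := by exact_mod_cast hx2
      have hxR : clampAbs x ≤ R ^ (1 / q) := by
        rw [clampAbs, abs_of_pos (by linarith), max_eq_left hx1']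
        exact hx2'.trans (Nat.floor_le (by positivity))
      calc clampAbs x ^ (q / ν) ≤ (R ^ (1 / q)) ^ (q / ν) :=
            Real.rpow_le_rpow (clampAbs_pos x).le hxR (by positivity)
        _ = R ^ (1 / ν) := by
            rw [← Real.rpow_mul hR0.le]
            congr 1
            field_simp
    have hDle : ∀ t ∈ I q₁ ×ˢ (I q₂ ×ˢ I q₃), D t ≤ c ^ ν * R := by
      intro t ht
      simp only [Finset.mem_product] at ht
      have hG : gauge₃ c₁ c₂ c₃ (q₁ / ν) (q₂ / ν) (q₃ / ν) t ≤ c * R ^ (1 / ν) := by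
        rw [hc, add_mul, add_mul, gauge₃]
        gcongr
        · exact hle hq₁ ht.1
        · exact hle hq₂ ht.2.1
        · exact hle hq₃ ht.2.2
      calc D t ≤ (c * R ^ (1 / ν)) ^ ν :=
            Real.rpow_le_rpow (gauge₃_pos h₁ h₂ h₃ t).le hG hν.le
        _ = c ^ ν * R := by
            rw [Real.mul_rpow hc0.le (by positivity), ← Real.rpow_mul hR0.le,
              one_div_mul_cancel hν.ne', Real.rpow_one]
    have hsumle : ((I q₁ ×ˢ (I q₂ ×ˢ I q₃)).card : ℝ) * (c ^ ν * R)⁻¹ ≤ ∑' t, (D t)⁻¹ := by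
      refine le_trans ?_ (hsum.sum_le_tsum (I q₁ ×ˢ (I q₂ ×ˢ I q₃))
        fun t _ => (inv_pos.2 (hDpos t)).le)
      rw [← nsmul_eq_mul]
      exact Finset.card_nsmul_le_sum _ _ _ fun t ht => inv_anti₀ (hDpos t) (hDle t ht)
    have hcard3 : R ^ (1 / q₁) / 2 * (R ^ (1 / q₂) / 2 * (R ^ (1 / q₃) / 2)) ≤
        ((I q₁ ×ˢ (I q₂ ×ˢ I q₃)).card : ℝ) := by
      rw [Finset.card_product, Finset.card_product, Nat.cast_mul, Nat.cast_mul]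
      have := hcard hq₁
      have := hcard hq₂
      have := hcard hq₃
      gcongr
    have hcR : 0 < c ^ ν * R := by positivity
    rw [← div_eq_mul_inv, div_le_iff₀ hcR] at hsumle
    rw [Real.rpow_sub hR0, Real.rpow_add hR0, Real.rpow_add hR0, Real.rpow_one, div_le_iff₀ hR0]
    linarith
  obtain ⟨R, hR1, hR2⟩ := (((tendsto_rpow_atTop (sub_pos.2 hQ)).eventually_gt_atTop
    (8 * c ^ ν * ∑' t, (D t)⁻¹)).and (eventually_ge_atTop 1)).exists
  exact absurd (hbound R hR2) (not_le.2 hR1)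

/-- The autocorrelation of a square summable, eventually positive, slowly varying, asymptotically
even and non-summable function is not absolutely summable. -/
theorem not_summable_abs_autocorrelation {G : Type*} [AddCommGroup G] [DecidableEq G]
    {a : G → ℝ} (hpos : ∀ᶠ t in cofinite, 0 < a t)
    (hsq : Summable fun t => a t ^ 2)
    (hshift : ∀ s, Tendsto (fun t => a (t + s) / a t) cofinite (nhds 1))
    (hneg : Tendsto (fun t => a (-t) / a t) cofinite (nhds 1))
    (hdiv : ¬ Summable a) :
    ¬ Summable fun t => |∑' s, a s * a (t + s)| := by
  intro hr
  obtain ⟨B, hB0, hB1⟩ : ∃ B : Finset G, (∀ t ∉ B, 0 < a t) ∧ 1 ≤ ∑ s ∈ B, a s := by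
    set S := (eventually_cofinite.1 hpos).toFinset with hS
    have hS0 : ∀ t ∉ S, 0 < a t := by
      intro t ht
      by_contra h
      exact ht (by simpa [hS] using h)
    by_contra! hcon
    apply hdiv
    have hsum : Summable fun t => if t ∈ S then 0 else a t := by
      refine summable_of_sum_le (c := 1 - ∑ s ∈ S, a s) ?_ ?_
      · intro t
        by_cases h : t ∈ S
        · simp [h]
        · simpa [h] using (hS0 t h).le
      · intro u
        have h1 := hcon (S ∪ u) (fun t ht => hS0 t (fun h => ht (Finset.mem_union_left _ h)))
        have h2 : ∑ t ∈ u, (if t ∈ S then 0 else a t) = ∑ t ∈ u \ S, a t := by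
          rw [Finset.sum_ite, Finset.sum_const_zero, zero_add, Finset.sdiff_eq_filter]
        have h3 : ∑ t ∈ S ∪ u, a t = ∑ t ∈ S, a t + ∑ t ∈ u \ S, a t := by
          rw [← Finset.union_sdiff_self_eq_union, Finset.sum_union Finset.disjoint_sdiff]
        linarith
    refine Summable.of_norm_bounded_eventually hsum ?_
    filter_upwards [hpos, (S.finite_toSet.eventually_cofinite_notMem)] with t ht htS
    have : t ∉ S := htS
    simp [this, abs_of_pos ht]
  have hinj : ∀ u : G, Tendsto (fun t => t - u) cofinite cofinite := fun u =>
    (sub_left_injective (b := u)).tendsto_cofinite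
  have hrefl : ∀ u, Tendsto (fun t => a (u - t) / a t) cofinite (nhds 1) := by
    intro u
    have h := (hneg.comp (hinj u)).mul (hshift (-u))
    rw [one_mul] at h
    refine h.congr' ?_
    filter_upwards [(hinj u).eventually hpos] with t ht
    simp only [Function.comp, neg_sub, ← sub_eq_add_neg]
    field_simp
  have hlim : Tendsto (fun t => ∑ s ∈ B, a s * (a (t + s) / a t) +
      ∑ u ∈ B, a u * (a (u - t) / a t)) cofinite
      (nhds (∑ s ∈ B, a s * 1 + ∑ u ∈ B, a u * 1)) :=
    (tendsto_finsetSum _ fun s _ => (hshift s).const_mul _).add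
      (tendsto_finsetSum _ fun u _ => (hrefl u).const_mul _)
  have hev := hlim.eventually (lt_mem_nhds (a := 1) (by simp only [mul_one]; linarith))
  apply hdiv
  refine Summable.of_norm_bounded_eventually hr ?_
  filter_upwards [hev, hpos,
    ((B ×ˢ B).image fun p => p.1 - p.2).finite_toSet.eventually_cofinite_notMem]
    with t h1 ht hdisj
  have hdisj' : Disjoint B (B.image fun u => u - t) := by
    rw [Finset.disjoint_left]
    intro x hx hx'
    obtain ⟨u, hu, rfl⟩ := Finset.mem_image.1 hx'
    exact hdisj (Finset.mem_coe.2 (Finset.mem_image.2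
      ⟨(u, u - t), Finset.mem_product.2 ⟨hu, hx⟩, by simp⟩))
  have hprod : Summable fun s => a s * a (t + s) := by
    have hsq' : Summable fun s => a (t + s) ^ 2 :=
      hsq.comp_injective (add_right_injective t)
    refine Summable.of_norm_bounded (hsq.add hsq') fun s => ?_
    rw [Real.norm_eq_abs, abs_le]
    constructor <;> nlinarith [sq_nonneg (a s + a (t + s)), sq_nonneg (a s - a (t + s))]
  have hle : ∑ s ∈ B ∪ B.image (fun u => u - t), a s * a (t + s) ≤ ∑' s, a s * a (t + s) := by
    refine hprod.sum_le_tsum _ fun s hs => ?_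
    rw [Finset.mem_union, not_or] at hs
    refine mul_nonneg (hB0 s hs.1).le (hB0 _ fun h => hs.2 ?_).le
    exact Finset.mem_image.2 ⟨t + s, h, by simp⟩
  rw [Finset.sum_union hdisj', Finset.sum_image (sub_left_injective (b := t)).injOn] at hle
  have heq : a t * (∑ s ∈ B, a s * (a (t + s) / a t) + ∑ u ∈ B, a u * (a (u - t) / a t)) =
      ∑ s ∈ B, a s * a (t + s) + ∑ u ∈ B, a (u - t) * a (t + (u - t)) := by
    rw [mul_add, Finset.mul_sum, Finset.mul_sum]
    congr 1 <;> refine Finset.sum_congr rfl fun s _ => ?_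
    · field_simp
    · rw [add_sub_cancel]
      field_simp
  rw [Real.norm_eq_abs, abs_of_pos ht]
  refine le_trans ?_ (le_abs_self _)
  calc a t = a t * 1 := (mul_one _).symm
    _ ≤ _ := mul_le_mul_of_nonneg_left h1.le ht.le
    _ = _ := heq
    _ ≤ _ := hle

/-- Let `|a|` be dominated by a product of a square summable and a summable function. Then the
autocorrelation of `a` is absolutely summable over the second coordinate. -/
theorem summable_abs_autocorrelation_slice {A B : Type*} [AddCommGroup A] [AddCommGroup B]
    {a : A × B → ℝ} {b : A → ℝ} {d : B → ℝ} (hb : Summable fun x => b x ^ 2)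
    (hd0 : ∀ y, 0 ≤ d y) (hd : Summable d) (h : ∀ t, |a t| ≤ b t.1 * d t.2) :
    Summable fun p => |∑' s, a s * a ((0, p) + s)| := by
  have hH : Summable fun u : A × B × B => b u.1 ^ 2 * (d u.2.1 * d u.2.2) :=
    hb.mul_of_nonneg (hd.mul_of_nonneg hd hd0 hd0) (fun x => sq_nonneg _)
      fun y => mul_nonneg (hd0 _) (hd0 _)
  have hinj : Function.Injective fun u : B × A × B => (u.2.1, u.2.2, u.1 + u.2.2) := by
    rintro ⟨p, x, y⟩ ⟨p', x', y'⟩ h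
    simp only [Prod.mk.injEq] at h
    obtain ⟨rfl, rfl, h⟩ := h
    rw [add_right_cancel h]
  have hF : Summable fun u : B × A × B => a u.2 * a ((0, u.1) + u.2) := by
    refine Summable.of_norm_bounded (hH.comp_injective hinj) fun u => ?_
    have h1 := h u.2
    have h2 := h ((0, u.1) + u.2)
    simp only [Prod.fst_add, Prod.snd_add, zero_add] at h2
    calc ‖a u.2 * a ((0, u.1) + u.2)‖ = |a u.2| * |a ((0, u.1) + u.2)| := by
          rw [Real.norm_eq_abs, abs_mul]
      _ ≤ (b u.2.1 * d u.2.2) * (b u.2.1 * d (u.1 + u.2.2)) :=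
          mul_le_mul h1 h2 (abs_nonneg _) ((abs_nonneg _).trans h1)
      _ = b u.2.1 ^ 2 * (d u.2.2 * d (u.1 + u.2.2)) := by ring
  refine Summable.of_norm_bounded hF.norm.prod fun p => ?_
  rw [Real.norm_eq_abs, abs_abs]
  exact norm_tsum_le_tsum_norm (hF.norm.prod_factor p)




theorem stmt_9 (q1 q2 q3 c1 c2 c3 ν : ℝ)
    (hq1 : 0 < q1) (hq2 : 0 < q2) (hq3 : 0 < q3)
    (hc1 : 0 < c1) (hc2 : 0 < c2) (hc3 : 0 < c3) (hν : 0 < ν)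
    (g : ℤ × ℤ × ℤ → ℝ) (hg : ∃ M : ℝ, ∀ t, |g t| ≤ M)
    (hg1 : Tendsto g cofinite (nhds 1))
    (a : ℤ × ℤ × ℤ → ℝ)
    (ha : ∀ t : ℤ × ℤ × ℤ, a t = g t /
      (c1 * (max |(t.1 : ℝ)| 1) ^ (q1 / ν) + c2 * (max |(t.2.1 : ℝ)| 1) ^ (q2 / ν) +
        c3 * (max |(t.2.2 : ℝ)| 1) ^ (q3 / ν)) ^ ν)
    (hQlow : 1 < 1 / q1 + 1 / q2 + 1 / q3)
    (hQup : 1 / q1 + 1 / q2 + 1 / q3 < 2)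
    (r : ℤ × ℤ × ℤ → ℝ)
    (hr : ∀ t : ℤ × ℤ × ℤ, r t = ∑' s : ℤ × ℤ × ℤ, a s * a (t + s))
    (hRegion : 1 / (2 * q1) + 1 / q2 + 1 / q3 < 1) :
    ¬ Summable (fun t : ℤ × ℤ × ℤ => |r t|) ∧
      Summable (fun p : ℤ × ℤ => |r (0, p.1, p.2)|) := by
  obtain ⟨M, hM⟩ := hg
  set D : ℤ × ℤ × ℤ → ℝ := fun t => gauge₃ c1 c2 c3 (q1 / ν) (q2 / ν) (q3 / ν) t ^ ν with hD
  have hEpos : ∀ t, 0 < gauge₃ c1 c2 c3 (q1 / ν) (q2 / ν) (q3 / ν) t := gauge₃_pos hc1 hc2 hc3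
  have hDpos : ∀ t, 0 < D t := fun t => Real.rpow_pos_of_pos (hEpos t) ν
  have haD : ∀ t, a t = g t / D t := ha
  obtain ⟨w₁, w₂, w₃, hw₁, hw₂, hw₃, hw⟩ : ∃ w₁ w₂ w₃ : ℝ,
      1 / (2 * q1) < w₁ ∧ 1 / q2 < w₂ ∧ 1 / q3 < w₃ ∧ w₁ + w₂ + w₃ = 1 := by
    set δ := 1 - (1 / (2 * q1) + 1 / q2 + 1 / q3) with hδ
    refine ⟨1 / (2 * q1) + δ / 3, 1 / q2 + δ / 3, 1 / q3 + δ / 3, ?_, ?_, ?_, ?_⟩ <;> linarith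
  have hα₁ : 1 < q1 * w₁ * 2 := by rw [div_lt_iff₀ (by positivity)] at hw₁; linarith
  have hα₂ : 1 < q2 * w₂ := by rw [div_lt_iff₀ hq2] at hw₂; linarith
  have hα₃ : 1 < q3 * w₃ := by rw [div_lt_iff₀ hq3] at hw₃; linarith
  obtain ⟨K, hK, hKD⟩ := exists_prod_rpow_le_gauge₃_rpow (β₁ := q1 / ν) (β₂ := q2 / ν)
    (β₃ := q3 / ν) hc1 hc2 hc3 hν ((by positivity : 0 ≤ 1 / (2 * q1)).trans hw₁.le)
    ((by positivity : 0 ≤ 1 / q2).trans hw₂.le) ((by positivity : 0 ≤ 1 / q3).trans hw₃.le) hw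
  simp only [div_mul_cancel₀ _ hν.ne'] at hKD
  have hpow0 : ∀ (α : ℝ) (x : ℤ), 0 < clampAbs x ^ α := fun α x =>
    Real.rpow_pos_of_pos (clampAbs_pos x) α
  set b : ℤ → ℝ := fun x => M / K * clampAbs x ^ (-(q1 * w₁)) with hb
  set d : ℤ × ℤ → ℝ := fun y => clampAbs y.1 ^ (-(q2 * w₂)) * clampAbs y.2 ^ (-(q3 * w₃)) with hd
  have hd0 : ∀ y, 0 ≤ d y := fun y => (mul_pos (hpow0 _ _) (hpow0 _ _)).le
  have hb_sum : Summable fun x => b x ^ 2 := by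
    refine ((summable_clampAbs_rpow_neg hα₁).mul_left ((M / K) ^ 2)).congr fun x => ?_
    rw [hb, mul_pow, ← Real.rpow_mul_natCast (clampAbs_pos x).le]
    norm_num
  have hd_sum : Summable d :=
    (summable_clampAbs_rpow_neg hα₂).mul_of_nonneg (summable_clampAbs_rpow_neg hα₃)
      (fun x => (hpow0 _ _).le) fun x => (hpow0 _ _).le
  have hM0 : 0 ≤ M := (abs_nonneg _).trans (hM 0)
  have hbound : ∀ t, |a t| ≤ b t.1 * d t.2 := by
    intro t
    have h₁ := hpow0 (q1 * w₁) t.1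
    have h₂ := hpow0 (q2 * w₂) t.2.1
    have h₃ := hpow0 (q3 * w₃) t.2.2
    rw [haD, abs_div, abs_of_pos (hDpos t)]
    calc |g t| / D t ≤ M / (K * (clampAbs t.1 ^ (q1 * w₁) *
          (clampAbs t.2.1 ^ (q2 * w₂) * clampAbs t.2.2 ^ (q3 * w₃)))) :=
          div_le_div₀ hM0 (hM t) (by positivity) (hKD t)
      _ = b t.1 * d t.2 := by
          simp only [hb, hd, Real.rpow_neg (clampAbs_pos _).le]
          field_simp
  have ha_sq : Summable fun t => a t ^ 2 := by
    have hd_sq : Summable fun y => d y ^ 2 := by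
      simpa only [sq, Function.comp_def] using
        (hd_sum.mul_of_nonneg hd_sum hd0 hd0).comp_injective
          (fun x y h => (Prod.mk.inj h).1 : Function.Injective fun y => (y, y))
    refine Summable.of_nonneg_of_le (fun t => sq_nonneg _) (fun t => ?_)
      (hb_sum.mul_of_nonneg hd_sq (fun x => sq_nonneg _) fun y => sq_nonneg _)
    rw [← mul_pow, ← sq_abs]
    exact pow_le_pow_left₀ (abs_nonneg _) (hbound t) 2
  have hr' : r = fun t => ∑' s, a s * a (t + s) := funext hr
  subst hr'
  have hgpos : ∀ᶠ t in cofinite, 1 / 2 < g t := hg1.eventually (lt_mem_nhds (by norm_num))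
  have hratio : ∀ φ : ℤ × ℤ × ℤ → ℤ × ℤ × ℤ, Function.Injective φ →
      Tendsto (fun t => D (φ t) / D t) cofinite (nhds 1) →
      Tendsto (fun t => a (φ t) / a t) cofinite (nhds 1) := by
    intro φ hφ h
    have h' := ((hg1.comp hφ.tendsto_cofinite).div hg1 one_ne_zero).div h one_ne_zero
    rw [div_one, div_one] at h'
    refine h'.congr' ?_
    filter_upwards [hgpos] with t ht
    have hg0 : g t ≠ 0 := by linarith
    have := (hDpos t).ne'
    have := (hDpos (φ t)).ne'
    simp only [Function.comp, Pi.div_apply, haD]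
    field_simp
  refine ⟨not_summable_abs_autocorrelation ?_ ha_sq (fun s => ?_) ?_ fun hsum => ?_,
    summable_abs_autocorrelation_slice hb_sum hd0 hd_sum hbound⟩
  · filter_upwards [hgpos] with t ht
    rw [haD]
    exact div_pos (by linarith) (hDpos t)
  · refine hratio (fun t => t + s) (add_left_injective s) ?_
    have h := (tendsto_gauge₃_add_div hc1 hc2 hc3 (div_pos hq1 hν) (div_pos hq2 hν)
      (div_pos hq3 hν) s).rpow_const (p := ν) (Or.inl one_ne_zero)
    rw [Real.one_rpow] at h
    exact h.congr fun t => Real.div_rpow (hEpos _).le (hEpos _).le _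
  · refine hratio (fun t => -t) neg_injective ?_
    refine tendsto_const_nhds.congr fun t => ?_
    simp only [hD, gauge₃_neg]
    exact (div_self (hDpos t).ne').symm
  · refine not_summable_inv_gauge₃_rpow hc1 hc2 hc3 hq1 hq2 hq3 hν hQlow ?_
    refine Summable.of_norm_bounded_eventually (hsum.mul_left 2) ?_
    filter_upwards [hgpos] with t ht
    rw [Real.norm_of_nonneg (inv_pos.2 (hDpos t)).le, haD, inv_eq_one_div, ← mul_div_assoc]
    exact div_le_div_of_nonneg_right (by linarith) (hDpos t).le
end

section
/- Assume 1/(2q1) + 1/(2q2) + 1/q3 < 1 < 1/(2q1) + 1/q2 + 1/q3. Fix x2, x3 > 0 and define f2(u1,u2,u3) := 1(0 < u3 < x3) · ∫_0^{x2} ∫_ℝ (c1·|u1|^{q1/ν} + c2·|t2−u2|^{q2/ν} + c3·|t3|^{q3/ν})^{−ν} dt2 dt3. Then ∫_{ℝ³} f2(u)² du < ∞, i.e. the Gaussian random field 𝒴₂ of the paper is well defined. -/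
open MeasureTheory

open scoped ENNReal

/-- The function equal to `r ^ (-p)` for `r ≤ R` and to `r ^ (-q)` for `r > R`. -/
noncomputable def twoPower (R p q : ℝ) (r : ℝ≥0∞) : ℝ≥0∞ :=
  if r ≤ ENNReal.ofReal R then r ^ (-p) else r ^ (-q)

@[fun_prop]
lemma measurable_twoPower (R p q : ℝ) : Measurable (twoPower R p q) :=
  Measurable.ite measurableSet_Iic (by fun_prop) (by fun_prop)

lemma twoPower_sq (R p q : ℝ) (r : ℝ≥0∞) :
    twoPower R p q r ^ 2 = twoPower R (2 * p) (2 * q) r := by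
  unfold twoPower
  split_ifs <;> rw [← ENNReal.rpow_natCast, ← ENNReal.rpow_mul] <;> congr 1 <;> push_cast <;> ring

lemma enorm_rpow_eq_ofReal {x : ℝ} (hx : 0 < x) (p : ℝ) :
    ‖x‖ₑ ^ p = ENNReal.ofReal (x ^ p) := by
  rw [Real.enorm_eq_ofReal hx.le, ENNReal.ofReal_rpow_of_pos hx]

lemma lintegral_comp_enorm_lt_top {F : ℝ≥0∞ → ℝ≥0∞}
    (h : ∫⁻ x in Set.Ioi (0 : ℝ), F ‖x‖ₑ < ⊤) : ∫⁻ x : ℝ, F ‖x‖ₑ < ⊤ := by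
  have h_neg : ∫⁻ x in Set.Iio (0 : ℝ), F ‖x‖ₑ = ∫⁻ x in Set.Ioi (0 : ℝ), F ‖x‖ₑ := by
    rw [← lintegral_indicator measurableSet_Iio, ← lintegral_indicator measurableSet_Ioi,
      ← lintegral_neg_eq_self]
    congr with x
    simp [Set.indicator_apply]
  have h_nonneg : ∫⁻ x in Set.Ici (0 : ℝ), F ‖x‖ₑ = ∫⁻ x in Set.Ioi (0 : ℝ), F ‖x‖ₑ :=
    setLIntegral_congr Ioi_ae_eq_Ici.symm
  rw [← lintegral_add_compl _ (measurableSet_Iio (a := (0 : ℝ))), Set.compl_Iio, h_neg, h_nonneg]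
  exact ENNReal.add_lt_top.2 ⟨h, h⟩

lemma lintegral_twoPower_enorm_lt_top {R p q : ℝ} (hR : 0 < R) (hp : p < 1) (hq : 1 < q) :
    ∫⁻ x : ℝ, twoPower R p q ‖x‖ₑ < ⊤ := by
  apply lintegral_comp_enorm_lt_top
  rw [← Set.Ioc_union_Ioi_eq_Ioi hR.le]
  refine (lintegral_union_le _ _ _).trans_lt (ENNReal.add_lt_top.2 ⟨?_, ?_⟩)
  · have h := (intervalIntegrable_iff_integrableOn_Ioc_of_le hR.le).1
      (intervalIntegral.intervalIntegrable_rpow' (a := 0) (b := R) (r := -p) (by linarith))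
    refine lt_of_le_of_lt (le_of_eq ?_) h.setLIntegral_lt_top
    refine setLIntegral_congr_fun measurableSet_Ioc fun x hx => ?_
    have hle : ‖x‖ₑ ≤ ENNReal.ofReal R := by
      rw [Real.enorm_eq_ofReal hx.1.le]
      exact ENNReal.ofReal_le_ofReal hx.2
    simp only [twoPower, if_pos hle, enorm_rpow_eq_ofReal hx.1]
  · have h := integrableOn_Ioi_rpow_of_lt (a := -q) (by linarith) hR
    refine lt_of_le_of_lt (le_of_eq ?_) h.setLIntegral_lt_top
    refine setLIntegral_congr_fun measurableSet_Ioi fun x hx => ?_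
    have hx' : 0 < x := hR.trans hx
    have hlt : ¬ ‖x‖ₑ ≤ ENNReal.ofReal R := by
      rw [Real.enorm_eq_ofReal hx'.le, not_le]
      exact (ENNReal.ofReal_lt_ofReal_iff hx').2 hx
    simp only [twoPower, if_neg hlt, enorm_rpow_eq_ofReal hx']

lemma ENNReal.rpow_neg_le_rpow_neg {a b : ℝ≥0∞} {p : ℝ} (h : a ≤ b) (hp : 0 ≤ p) :
    b ^ (-p) ≤ a ^ (-p) := by
  rw [ENNReal.rpow_neg, ENNReal.rpow_neg]
  exact ENNReal.inv_le_inv.2 (ENNReal.rpow_le_rpow h hp)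

lemma setLIntegral_sub_enorm_rpow_le_of_near {x u d : ℝ} (hu : |u| ≤ 2 * x) :
    ∫⁻ t in Set.Ioc 0 x, ‖t - u‖ₑ ^ (-d) ≤ ∫⁻ s : ℝ, twoPower (3 * x) d 2 ‖s‖ₑ := by
  rw [← lintegral_sub_right_eq_self (fun s => twoPower (3 * x) d 2 ‖s‖ₑ) u]
  refine le_trans ?_ (setLIntegral_le_lintegral (Set.Ioc 0 x) _)
  refine setLIntegral_mono' measurableSet_Ioc fun t ht => ?_
  have hle : ‖t - u‖ₑ ≤ ENNReal.ofReal (3 * x) := by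
    rw [Real.enorm_eq_ofReal_abs]
    refine ENNReal.ofReal_le_ofReal (abs_le.2 ?_)
    have := abs_le.1 hu
    constructor <;> linarith [ht.1, ht.2]
  simp only [twoPower, if_pos hle, le_refl]

lemma setLIntegral_sub_enorm_rpow_le_of_far {x u d : ℝ} (hd : 0 ≤ d) (hu : 2 * x < |u|) :
    ∫⁻ t in Set.Ioc 0 x, ‖t - u‖ₑ ^ (-d) ≤
      (2⁻¹ : ℝ≥0∞) ^ (-d) * ENNReal.ofReal x * ‖u‖ₑ ^ (-d) := by
  have hb : ∀ t ∈ Set.Ioc 0 x, ‖t - u‖ₑ ^ (-d) ≤ (2⁻¹ : ℝ≥0∞) ^ (-d) * ‖u‖ₑ ^ (-d) := by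
    intro t ht
    rw [← ENNReal.mul_rpow_of_ne_top (by simp) (by simp)]
    refine ENNReal.rpow_neg_le_rpow_neg ?_ hd
    have h2 : (2⁻¹ : ℝ≥0∞) = ENNReal.ofReal 2⁻¹ := by
      rw [ENNReal.ofReal_inv_of_pos two_pos]; simp
    rw [h2, Real.enorm_eq_ofReal_abs, Real.enorm_eq_ofReal_abs,
      ← ENNReal.ofReal_mul (by norm_num)]
    refine ENNReal.ofReal_le_ofReal ?_
    have h3 : |u| ≤ |t - u| + |t| := by
      simpa [abs_sub_comm] using abs_sub_abs_le_abs_sub u t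
    rw [abs_of_pos ht.1] at h3
    linarith [ht.2]
  refine (setLIntegral_mono' measurableSet_Ioc hb).trans (le_of_eq ?_)
  rw [setLIntegral_const, Real.volume_Ioc, sub_zero]
  ring

lemma lintegral_sq_setLIntegral_sub_enorm_rpow_lt_top {x d : ℝ} (hx : 0 < x)
    (hd : 1 / 2 < d) (hd' : d < 1) :
    ∫⁻ u : ℝ, (∫⁻ t in Set.Ioc 0 x, ‖t - u‖ₑ ^ (-d)) ^ 2 < ⊤ := by
  set K := ∫⁻ s : ℝ, twoPower (3 * x) d 2 ‖s‖ₑ with hK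
  have hKtop : K < ⊤ := lintegral_twoPower_enorm_lt_top (by positivity) hd' (by norm_num)
  set C : ℝ≥0∞ := (2⁻¹ : ℝ≥0∞) ^ (-d) * ENNReal.ofReal x with hC
  have hCtop : C ≠ ⊤ := by
    refine ENNReal.mul_ne_top ?_ ENNReal.ofReal_ne_top
    rw [ENNReal.inv_rpow, ENNReal.rpow_neg, inv_inv]
    exact ENNReal.rpow_ne_top_of_nonneg (by linarith) (by simp)
  have hle : ∀ u : ℝ, (∫⁻ t in Set.Ioc 0 x, ‖t - u‖ₑ ^ (-d)) ^ 2 ≤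
      K ^ 2 * twoPower (2 * x) 0 2 ‖u‖ₑ + C ^ 2 * twoPower (2 * x) 0 (2 * d) ‖u‖ₑ := by
    intro u
    by_cases hu : |u| ≤ 2 * x
    · refine le_trans ?_ le_self_add
      have : ‖u‖ₑ ≤ ENNReal.ofReal (2 * x) := by
        rw [Real.enorm_eq_ofReal_abs]; exact ENNReal.ofReal_le_ofReal hu
      simp only [twoPower, if_pos this, neg_zero, ENNReal.rpow_zero, mul_one]
      gcongr
      exact setLIntegral_sub_enorm_rpow_le_of_near hu
    · refine le_trans ?_ le_add_self
      rw [not_le] at hu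
      have : ¬ ‖u‖ₑ ≤ ENNReal.ofReal (2 * x) := by
        rw [Real.enorm_eq_ofReal_abs, not_le]
        exact (ENNReal.ofReal_lt_ofReal_iff (by linarith)).2 hu
      have h2 : ‖u‖ₑ ^ (-(2 * d)) = (‖u‖ₑ ^ (-d)) ^ 2 := by
        rw [← ENNReal.rpow_natCast, ← ENNReal.rpow_mul]; congr 1; push_cast; ring
      simp only [twoPower, if_neg this, h2, ← mul_pow]
      gcongr
      exact setLIntegral_sub_enorm_rpow_le_of_far (by linarith) hu
  refine (lintegral_mono hle).trans_lt ?_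
  rw [lintegral_add_left (by fun_prop), lintegral_const_mul _ (by fun_prop),
    lintegral_const_mul _ (by fun_prop)]
  have h2x : 0 < 2 * x := by positivity
  exact ENNReal.add_lt_top.2
    ⟨ENNReal.mul_lt_top (ENNReal.pow_lt_top hKtop)
      (lintegral_twoPower_enorm_lt_top h2x (by norm_num) (by norm_num)),
    ENNReal.mul_lt_top (ENNReal.pow_lt_top hCtop.lt_top)
      (lintegral_twoPower_enorm_lt_top h2x (by norm_num) (by linarith))⟩

lemma rpow_neg_mul_le_enorm {ν q m x S a : ℝ} (hν : 0 < ν) (hm : 0 < m) (hx : x ≠ 0)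
    (ha : 0 ≤ a) (hS : m * |x| ^ (q / ν) ≤ S) :
    ENNReal.ofReal (S ^ (-(ν * a))) ≤ ENNReal.ofReal (m ^ (-(ν * a))) * ‖x‖ₑ ^ (-(q * a)) := by
  have hx' : 0 < |x| := abs_pos.2 hx
  rw [Real.enorm_eq_ofReal_abs, ENNReal.ofReal_rpow_of_pos hx',
    ← ENNReal.ofReal_mul (by positivity)]
  refine ENNReal.ofReal_le_ofReal ?_
  have hνa : -(ν * a) ≤ 0 := by nlinarith
  refine (Real.rpow_le_rpow_of_nonpos (by positivity) hS hνa).trans (le_of_eq ?_)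
  rw [Real.mul_rpow hm.le (by positivity), ← Real.rpow_mul hx'.le]
  congr 2
  field_simp

/-- Each of the three summands is dominated by the whole sum, so an anisotropic power of the sum
is dominated by a product of powers of the coordinates. -/
lemma ofReal_rpow_neg_le_mul_enorm_rpow {q1 q2 q3 c1 c2 c3 ν α β γ : ℝ}
    (hq1 : 0 < q1) (hq2 : 0 < q2) (hq3 : 0 < q3)
    (hc1 : 0 < c1) (hc2 : 0 < c2) (hc3 : 0 < c3) (hν : 0 < ν)
    (hα : 0 < α) (hβ : 0 < β) (hγ : 0 < γ) (hsum : α + β + γ = 1) (x y z : ℝ) :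
    ENNReal.ofReal ((c1 * |x| ^ (q1 / ν) + c2 * |y| ^ (q2 / ν) + c3 * |z| ^ (q3 / ν)) ^ (-ν)) ≤
      ENNReal.ofReal (min (min c1 c2) c3 ^ (-ν)) * (‖x‖ₑ ^ (-(q1 * α)) *
        ‖y‖ₑ ^ (-(q2 * β)) * ‖z‖ₑ ^ (-(q3 * γ))) := by
  set m := min (min c1 c2) c3 with hm_def
  have hm : 0 < m := lt_min (lt_min hc1 hc2) hc3
  have hK : ENNReal.ofReal (m ^ (-ν)) ≠ 0 := by
    simpa using Real.rpow_pos_of_pos hm _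
  have hne : ∀ (w : ℝ) {p : ℝ}, 0 < p → ‖w‖ₑ ^ (-p) ≠ 0 := fun w p hp => by
    simp [ENNReal.rpow_eq_zero_iff, hp.le]
  have hx0 := hne x (mul_pos hq1 hα)
  have hy0 := hne y (mul_pos hq2 hβ)
  have hz0 := hne z (mul_pos hq3 hγ)
  have htop : ∀ {p : ℝ}, 0 < p → ‖(0 : ℝ)‖ₑ ^ (-p) = ⊤ := fun {p} hp => by
    rw [enorm_zero, ENNReal.zero_rpow_of_neg (by linarith)]
  rcases eq_or_ne x 0 with rfl | hx
  · rw [htop (mul_pos hq1 hα), ENNReal.top_mul hy0, ENNReal.top_mul hz0, ENNReal.mul_top hK]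
    exact le_top
  rcases eq_or_ne y 0 with rfl | hy
  · rw [htop (mul_pos hq2 hβ), ENNReal.mul_top hx0, ENNReal.top_mul hz0, ENNReal.mul_top hK]
    exact le_top
  rcases eq_or_ne z 0 with rfl | hz
  · rw [htop (mul_pos hq3 hγ), ENNReal.mul_top (mul_ne_zero hx0 hy0), ENNReal.mul_top hK]
    exact le_top
  have hX : 0 < |x| ^ (q1 / ν) := Real.rpow_pos_of_pos (abs_pos.2 hx) _
  have hY : 0 < |y| ^ (q2 / ν) := Real.rpow_pos_of_pos (abs_pos.2 hy) _
  have hZ : 0 < |z| ^ (q3 / ν) := Real.rpow_pos_of_pos (abs_pos.2 hz) _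
  have hm1 : m ≤ c1 := (min_le_left _ _).trans (min_le_left _ _)
  have hm2 : m ≤ c2 := (min_le_left _ _).trans (min_le_right _ _)
  have hm3 : m ≤ c3 := min_le_right _ _
  have h1 := mul_le_mul_of_nonneg_right hm1 hX.le
  have h2 := mul_le_mul_of_nonneg_right hm2 hY.le
  have h3 := mul_le_mul_of_nonneg_right hm3 hZ.le
  have p1 := mul_pos hc1 hX
  have p2 := mul_pos hc2 hY
  have p3 := mul_pos hc3 hZ
  set S := c1 * |x| ^ (q1 / ν) + c2 * |y| ^ (q2 / ν) + c3 * |z| ^ (q3 / ν) with hS_def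
  have hS : 0 < S := by positivity
  have hsplit : ∀ w : ℝ, 0 < w → ENNReal.ofReal (w ^ (-ν)) = ENNReal.ofReal (w ^ (-(ν * α))) *
      ENNReal.ofReal (w ^ (-(ν * β))) * ENNReal.ofReal (w ^ (-(ν * γ))) := by
    intro w hw
    rw [← ENNReal.ofReal_mul (by positivity), ← ENNReal.ofReal_mul (by positivity),
      ← Real.rpow_add hw, ← Real.rpow_add hw]
    congr 2
    linear_combination (-ν) * (-hsum)
  rw [hsplit S hS, hsplit m hm]
  calc _ ≤ _ := mul_le_mul' (mul_le_mul'
        (rpow_neg_mul_le_enorm hν hm hx hα.le (by linarith))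
        (rpow_neg_mul_le_enorm hν hm hy hβ.le (by linarith)))
        (rpow_neg_mul_le_enorm hν hm hz hγ.le (by linarith))
    _ = _ := by ring

lemma ENNReal.rpow_neg_le_add_rpow_neg (r : ℝ≥0∞) {p s t : ℝ} (hs : s ≤ p) (ht : p ≤ t) :
    r ^ (-p) ≤ r ^ (-s) + r ^ (-t) := by
  rcases le_total r 1 with hr | hr
  · exact (ENNReal.rpow_le_rpow_of_exponent_ge hr (by linarith)).trans le_add_self
  · exact (ENNReal.rpow_le_rpow_of_exponent_le hr (by linarith)).trans le_self_add

theorem stmt_13 (q1 q2 q3 c1 c2 c3 ν x2 x3 : ℝ)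
    (hq1 : 0 < q1) (hq2 : 0 < q2) (hq3 : 0 < q3)
    (hc1 : 0 < c1) (hc2 : 0 < c2) (hc3 : 0 < c3) (hν : 0 < ν)
    (hx2 : 0 < x2) (hx3 : 0 < x3)
    (hlow : 1 / (2 * q1) + 1 / (2 * q2) + 1 / q3 < 1)
    (hup : 1 < 1 / (2 * q1) + 1 / q2 + 1 / q3) :
    (∫⁻ u : ℝ × ℝ × ℝ,
      ({u : ℝ × ℝ × ℝ | 0 < u.2.2 ∧ u.2.2 < x3}.indicator
        (fun u => ∫⁻ t2 in Set.Ioc (0 : ℝ) x2, ∫⁻ t3 : ℝ,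
          ENNReal.ofReal ((c1 * |u.1| ^ (q1 / ν) + c2 * |t2 - u.2.1| ^ (q2 / ν) +
            c3 * |t3| ^ (q3 / ν)) ^ (-ν))) u) ^ 2) < ⊤ := by
  obtain ⟨a, ha⟩ : ∃ a, a = 1 / (2 * q1) := ⟨_, rfl⟩
  obtain ⟨c, hc⟩ : ∃ c, c = 1 / q3 := ⟨_, rfl⟩
  obtain ⟨b, hb⟩ : ∃ b, b = 1 - a - c := ⟨_, rfl⟩
  have ha0 : 0 < a := by rw [ha]; positivity
  have hc0 : 0 < c := by rw [hc]; positivity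
  have hq2' : 0 < 1 / (2 * q2) := by positivity
  have hb1 : 1 / (2 * q2) < b := by rw [hb, ha, hc]; linarith
  have hb2 : b < 1 / q2 := by rw [hb, ha, hc]; linarith
  obtain ⟨ε, hε, hεlt⟩ : ∃ ε, 0 < ε ∧
      ε < min (min a c) (min ((b - 1 / (2 * q2)) / 2) ((1 / q2 - b) / 2)) :=
    exists_between (lt_min (lt_min ha0 hc0) (lt_min (by linarith) (by linarith)))
  simp only [lt_min_iff] at hεlt
  obtain ⟨⟨hεa, hεc⟩, hεb1, hεb2⟩ := hεlt
  have ha' : 2 * (q1 * a) = 1 := by rw [ha]; field_simp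
  have hc' : q3 * c = 1 := by rw [hc]; field_simp
  have hd1 : 1 / 2 < q2 * (b - 2 * ε) := by
    have h : q2 * (1 / (2 * q2)) < q2 * (b - 2 * ε) :=
      mul_lt_mul_of_pos_left (by linarith) hq2
    have h' : q2 * (1 / (2 * q2)) = 1 / 2 := by field_simp
    linarith
  have hd2 : q2 * (b + 2 * ε) < 1 := by
    have h : q2 * (b + 2 * ε) < q2 * (1 / q2) :=
      mul_lt_mul_of_pos_left (by linarith) hq2
    have h' : q2 * (1 / q2) = 1 := by field_simp
    linarith
  have hq1ε := mul_pos hq1 hε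
  have hq2ε := mul_pos hq2 hε
  have hq3ε := mul_pos hq3 hε
  set K := ENNReal.ofReal (min (min c1 c2) c3 ^ (-ν)) with hK
  set A : ℝ → ℝ≥0∞ := fun x => twoPower 1 (q1 * (a - ε)) (q1 * (a + ε)) ‖x‖ₑ with hA
  set D : ℝ → ℝ≥0∞ := fun x => twoPower 1 (q3 * (c - ε)) (q3 * (c + ε)) ‖x‖ₑ with hD
  set B : ℝ → ℝ≥0∞ := fun y => ‖y‖ₑ ^ (-(q2 * (b - 2 * ε))) + ‖y‖ₑ ^ (-(q2 * (b + 2 * ε)))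
    with hB
  have hAm : Measurable A := by fun_prop
  have hDm : Measurable D := by fun_prop
  have hBm : Measurable B := by fun_prop
  have hbound : ∀ x y z : ℝ,
      ENNReal.ofReal ((c1 * |x| ^ (q1 / ν) + c2 * |y| ^ (q2 / ν) + c3 * |z| ^ (q3 / ν)) ^ (-ν)) ≤
        K * (A x * B y * D z) := by
    intro x y z
    have key : ∀ α γ : ℝ, a - ε ≤ α → α ≤ a + ε → c - ε ≤ γ → γ ≤ c + ε →
        ENNReal.ofReal ((c1 * |x| ^ (q1 / ν) + c2 * |y| ^ (q2 / ν) +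
          c3 * |z| ^ (q3 / ν)) ^ (-ν)) ≤
          K * (‖x‖ₑ ^ (-(q1 * α)) * B y * ‖z‖ₑ ^ (-(q3 * γ))) := by
      intro α γ h1 h2 h3 h4
      refine (ofReal_rpow_neg_le_mul_enorm_rpow (α := α) (β := 1 - α - γ) (γ := γ)
        hq1 hq2 hq3 hc1 hc2 hc3 hν (by linarith) (by linarith) (by linarith) (by ring) x y z).trans ?_
      have hBy : ‖y‖ₑ ^ (-(q2 * (1 - α - γ))) ≤ B y :=
        ENNReal.rpow_neg_le_add_rpow_neg _
          (mul_le_mul_of_nonneg_left (by linarith) hq2.le)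
          (mul_le_mul_of_nonneg_left (by linarith) hq2.le)
      gcongr
    simp only [hA, hD, twoPower]
    split_ifs <;> apply key <;> linarith
  set H : ℝ → ℝ≥0∞ := fun u => ∫⁻ t in Set.Ioc (0 : ℝ) x2, B (t - u) with hH
  have hHm : Measurable H := by
    refine Measurable.lintegral_prod_right' (f := fun p : ℝ × ℝ => B (p.2 - p.1)) ?_
    fun_prop
  set I := ∫⁻ z, D z with hI
  have hItop : I < ⊤ :=
    lintegral_twoPower_enorm_lt_top one_pos (by linarith) (by linarith)
  have hAtop : ∫⁻ x, A x ^ 2 < ⊤ := by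
    simp only [hA, twoPower_sq]
    exact lintegral_twoPower_enorm_lt_top one_pos (by linarith) (by linarith)
  have hHtop : ∫⁻ u, H u ^ 2 < ⊤ := by
    have hsplit : ∀ u, H u ^ 2 ≤
        2 * (∫⁻ t in Set.Ioc (0 : ℝ) x2, ‖t - u‖ₑ ^ (-(q2 * (b - 2 * ε)))) ^ 2 +
        2 * (∫⁻ t in Set.Ioc (0 : ℝ) x2, ‖t - u‖ₑ ^ (-(q2 * (b + 2 * ε)))) ^ 2 := by
      intro u
      simp only [hH, hB]
      rw [lintegral_add_left (by fun_prop), ← mul_add]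
      have := ENNReal.rpow_add_le_mul_rpow_add_rpow
        (∫⁻ t in Set.Ioc (0 : ℝ) x2, ‖t - u‖ₑ ^ (-(q2 * (b - 2 * ε))))
        (∫⁻ t in Set.Ioc (0 : ℝ) x2, ‖t - u‖ₑ ^ (-(q2 * (b + 2 * ε)))) (one_le_two (α := ℝ))
      norm_num at this
      exact this
    have hm : ∀ d : ℝ, Measurable fun u : ℝ =>
        (∫⁻ t in Set.Ioc (0 : ℝ) x2, ‖t - u‖ₑ ^ (-d)) ^ 2 := fun d =>
      (Measurable.lintegral_prod_right' (f := fun p : ℝ × ℝ => ‖p.2 - p.1‖ₑ ^ (-d))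
        (by fun_prop)).pow_const 2
    refine (lintegral_mono hsplit).trans_lt ?_
    rw [lintegral_add_left ((hm _).const_mul 2), lintegral_const_mul _ (hm _),
      lintegral_const_mul _ (hm _)]
    exact ENNReal.add_lt_top.2
      ⟨ENNReal.mul_lt_top (by simp)
        (lintegral_sq_setLIntegral_sub_enorm_rpow_lt_top hx2 hd1 (by linarith)),
      ENNReal.mul_lt_top (by simp)
        (lintegral_sq_setLIntegral_sub_enorm_rpow_lt_top hx2 (by linarith) hd2)⟩
  set J : ℝ → ℝ≥0∞ := (Set.Ioo 0 x3).indicator 1 with hJ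
  have hJm : Measurable J := measurable_one.indicator measurableSet_Ioo
  have hJtop : ∫⁻ w, J w < ⊤ := by
    rw [hJ, lintegral_indicator_one measurableSet_Ioo, Real.volume_Ioo]
    exact ENNReal.ofReal_lt_top
  have hle : ∀ u : ℝ × ℝ × ℝ,
      ({u : ℝ × ℝ × ℝ | 0 < u.2.2 ∧ u.2.2 < x3}.indicator
        (fun u => ∫⁻ t2 in Set.Ioc (0 : ℝ) x2, ∫⁻ t3 : ℝ,
          ENNReal.ofReal ((c1 * |u.1| ^ (q1 / ν) + c2 * |t2 - u.2.1| ^ (q2 / ν) +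
            c3 * |t3| ^ (q3 / ν)) ^ (-ν))) u) ^ 2 ≤
      (K * I) ^ 2 * (A u.1 ^ 2 * (H u.2.1 ^ 2 * J u.2.2)) := by
    rintro ⟨x, y, w⟩
    by_cases hw : 0 < w ∧ w < x3
    · have hJw : J w = 1 := by simp [hJ, hw]
      rw [Set.indicator_of_mem (by exact hw)]
      simp only [hJw, mul_one]
      calc _ ≤ (∫⁻ t2 in Set.Ioc (0 : ℝ) x2, ∫⁻ t3 : ℝ, K * (A x * B (t2 - y) * D t3)) ^ 2 := by
            gcongr with t2 t3
            exact hbound _ _ _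
        _ = (K * I * A x * H y) ^ 2 := by
            congr 1
            have h1 : ∀ t2 : ℝ, ∫⁻ t3 : ℝ, K * (A x * B (t2 - y) * D t3) =
                (K * I * A x) * B (t2 - y) := fun t2 => by
              rw [lintegral_const_mul _ (by fun_prop), lintegral_const_mul _ (by fun_prop)]
              ring
            simp only [h1]
            rw [lintegral_const_mul _ (by fun_prop)]
        _ = _ := by ring
    · rw [Set.indicator_of_notMem (by exact hw)]
      simp
  refine (lintegral_mono hle).trans_lt ?_
  rw [lintegral_const_mul _ (by fun_prop), Measure.volume_eq_prod,
    lintegral_prod_mul (f := fun x => A x ^ 2) (g := fun p : ℝ × ℝ => H p.1 ^ 2 * J p.2)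
      (by fun_prop) (by fun_prop), Measure.volume_eq_prod,
    lintegral_prod_mul (f := fun x => H x ^ 2) (g := J) (by fun_prop) (by fun_prop)]
  exact ENNReal.mul_lt_top (ENNReal.pow_lt_top (ENNReal.mul_lt_top ENNReal.ofReal_lt_top hItop))
    (ENNReal.mul_lt_top hAtop (ENNReal.mul_lt_top hHtop hJtop))
end

section
/- Assume 1/(2q1) + 1/(2q2) + 1/(2q3) < 1 < 1/(2q1) + 1/(2q2) + 1/q3. Fix x3 > 0 and define f3(u1,u2,u3) := ∫_0^{x3} (c1·|u1|^{q1/ν} + c2·|u2|^{q2/ν} + c3·|t−u3|^{q3/ν})^{−ν} dt. Then ∫_{ℝ³} f3(u)² du < ∞, i.e. the Gaussian random field 𝒴₃ of the paper is well defined. -/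
open MeasureTheory

/-- The function equal to `|x| ^ (-p)` near the origin and to `|x| ^ (-r)` near infinity. -/
noncomputable def twoPowerKernel (p r : ℝ) (x : ℝ) : ENNReal :=
  if |x| ≤ 1 then ENNReal.ofReal |x| ^ (-p) else ENNReal.ofReal |x| ^ (-r)

lemma measurable_twoPowerKernel (p r : ℝ) : Measurable (twoPowerKernel p r) := by
  unfold twoPowerKernel
  refine Measurable.ite (measurableSet_le (by fun_prop) (by fun_prop)) ?_ ?_ <;> fun_prop

lemma twoPowerKernel_sq (p r x : ℝ) :
    twoPowerKernel p r x ^ 2 = twoPowerKernel (2 * p) (2 * r) x := by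
  unfold twoPowerKernel
  split_ifs <;> rw [← ENNReal.rpow_natCast, ← ENNReal.rpow_mul] <;> congr 1 <;> push_cast <;> ring

lemma twoPowerKernel_le_add (p r p' r' x : ℝ) :
    twoPowerKernel p r x ≤ twoPowerKernel p r' x + twoPowerKernel p' r x := by
  unfold twoPowerKernel
  split_ifs
  · exact le_self_add
  · exact le_add_self

lemma ENNReal.rpow_neg_le_rpow_neg_s14 {x y : ENNReal} {z : ℝ} (hxy : x ≤ y) (hz : 0 ≤ z) :
    y ^ (-z) ≤ x ^ (-z) := by
  rw [ENNReal.rpow_neg, ENNReal.rpow_neg]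
  exact ENNReal.inv_le_inv.2 (ENNReal.rpow_le_rpow hxy hz)

lemma setLIntegral_Ioi_twoPowerKernel_lt_top {p r : ℝ} (hp : p < 1) (hr : 1 < r) :
    ∫⁻ x in Set.Ioi 0, twoPowerKernel p r x < ⊤ := by
  have h1 : IntegrableOn (fun x : ℝ => x ^ (-p)) (Set.Ioc 0 1) :=
    (intervalIntegrable_iff_integrableOn_Ioc_of_le zero_le_one).1
      (intervalIntegral.intervalIntegrable_rpow' (by linarith))
  have h2 : IntegrableOn (fun x : ℝ => x ^ (-r)) (Set.Ioi 1) :=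
    integrableOn_Ioi_rpow_of_lt (by linarith) one_pos
  have e1 : ∫⁻ x in Set.Ioc 0 1, twoPowerKernel p r x < ⊤ := by
    refine lt_of_eq_of_lt (setLIntegral_congr_fun measurableSet_Ioc fun x hx => ?_)
      h1.lintegral_lt_top
    simp only [twoPowerKernel, abs_of_pos hx.1, if_pos hx.2]
    exact ENNReal.ofReal_rpow_of_pos hx.1
  have e2 : ∫⁻ x in Set.Ioi 1, twoPowerKernel p r x < ⊤ := by
    refine lt_of_eq_of_lt (setLIntegral_congr_fun measurableSet_Ioi fun x hx => ?_)
      h2.lintegral_lt_top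
    have hx0 : 0 < x := zero_lt_one.trans hx
    simp only [twoPowerKernel, abs_of_pos hx0, if_neg (not_le.2 (Set.mem_Ioi.1 hx))]
    exact ENNReal.ofReal_rpow_of_pos hx0
  rw [← Set.Ioc_union_Ioi_eq_Ioi (zero_le_one' ℝ)]
  exact (lintegral_union_le _ _ _).trans_lt (ENNReal.add_lt_top.2 ⟨e1, e2⟩)

lemma lintegral_twoPowerKernel_lt_top {p r : ℝ} (hp : p < 1) (hr : 1 < r) :
    ∫⁻ x, twoPowerKernel p r x < ⊤ := by
  have h := setLIntegral_Ioi_twoPowerKernel_lt_top hp hr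
  have hneg : ∫⁻ x in Set.Iio 0, twoPowerKernel p r x =
      ∫⁻ x in Set.Ioi 0, twoPowerKernel p r x := by
    have := (Measure.measurePreserving_neg (volume : Measure ℝ)).setLIntegral_comp_preimage
      (s := Set.Ioi (0 : ℝ)) measurableSet_Ioi (measurable_twoPowerKernel p r)
    simpa [twoPowerKernel] using this
  rw [← setLIntegral_univ, ← Set.Iic_union_Ioi (a := (0 : ℝ))]
  refine (lintegral_union_le _ _ _).trans_lt (ENNReal.add_lt_top.2 ⟨?_, h⟩)
  rw [setLIntegral_congr Iio_ae_eq_Iic.symm, hneg]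
  exact h

lemma rpow_neg_le_twoPowerKernel_of_one_le {q ν α p x : ℝ} {N : ENNReal} (hν : 0 < ν)
    (hα : 0 ≤ α) (hp : 0 ≤ p) (hN : 1 ≤ N) (hx : ENNReal.ofReal |x| ^ (q / ν) ≤ N) :
    N ^ (-(ν * α)) ≤ twoPowerKernel p (q * α) x := by
  unfold twoPowerKernel
  split_ifs with h
  · calc N ^ (-(ν * α)) ≤ 1 ^ (-(ν * α)) := ENNReal.rpow_neg_le_rpow_neg_s14 hN (by positivity)
      _ = 1 ^ (-p) := by simp
      _ ≤ _ := ENNReal.rpow_neg_le_rpow_neg_s14 (by simpa using h) hp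
  · refine (ENNReal.rpow_neg_le_rpow_neg_s14 hx (by positivity)).trans_eq ?_
    rw [← ENNReal.rpow_mul]
    congr 1
    field_simp

lemma rpow_neg_le_twoPowerKernel_of_lt_one {q ν β r x : ℝ} {N : ENNReal} (hν : 0 < ν)
    (hq : 0 < q) (hβ : 0 ≤ β) (hN : N < 1) (hx : ENNReal.ofReal |x| ^ (q / ν) ≤ N) :
    N ^ (-(ν * β)) ≤ twoPowerKernel (q * β) r x := by
  unfold twoPowerKernel
  rw [if_pos]
  · refine (ENNReal.rpow_neg_le_rpow_neg_s14 hx (by positivity)).trans_eq ?_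
    rw [← ENNReal.rpow_mul]
    congr 1
    field_simp
  · by_contra h
    refine (hx.trans_lt hN).not_ge ?_
    exact ENNReal.one_le_rpow (by simpa using (not_le.1 h).le) (by positivity)

lemma ENNReal.rpow_neg_eq_mul_of_add_eq_one {N : ENNReal} (h0 : N ≠ 0) (ht : N ≠ ⊤) (ν : ℝ)
    {a b c : ℝ} (h : a + b + c = 1) :
    N ^ (-ν) = N ^ (-(ν * a)) * (N ^ (-(ν * b)) * N ^ (-(ν * c))) := by
  rw [← ENNReal.rpow_add _ _ h0 ht, ← ENNReal.rpow_add _ _ h0 ht]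
  congr 1
  linear_combination ν * h

lemma ofReal_sum_rpow_neg_le {q1 q2 q3 c1 c2 c3 ν α1 α2 α3 β1 β2 β3 : ℝ}
    (hq1 : 0 < q1) (hq2 : 0 < q2) (hq3 : 0 < q3)
    (hc1 : 0 < c1) (hc2 : 0 < c2) (hc3 : 0 < c3) (hν : 0 < ν)
    (hα1 : 0 ≤ α1) (hα2 : 0 ≤ α2) (hα3 : 0 ≤ α3) (hα : α1 + α2 + α3 = 1)
    (hβ1 : 0 ≤ β1) (hβ2 : 0 ≤ β2) (hβ3 : 0 ≤ β3) (hβ : β1 + β2 + β3 = 1) (x y z : ℝ) :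
    ENNReal.ofReal ((c1 * |x| ^ (q1 / ν) + c2 * |y| ^ (q2 / ν) + c3 * |z| ^ (q3 / ν)) ^ (-ν)) ≤
      ENNReal.ofReal (min c1 (min c2 c3) ^ (-ν)) * (twoPowerKernel (q1 * β1) (q1 * α1) x *
        (twoPowerKernel (q2 * β2) (q2 * α2) y * twoPowerKernel (q3 * β3) (q3 * α3) z)) := by
  set c := min c1 (min c2 c3) with hc
  have hcpos : 0 < c := lt_min hc1 (lt_min hc2 hc3)
  have hX : 0 ≤ |x| ^ (q1 / ν) := by positivity
  have hY : 0 ≤ |y| ^ (q2 / ν) := by positivity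
  have hZ : 0 ≤ |z| ^ (q3 / ν) := by positivity
  set X := |x| ^ (q1 / ν) with hXdef
  set Y := |y| ^ (q2 / ν) with hYdef
  set Z := |z| ^ (q3 / ν) with hZdef
  rcases (add_nonneg (add_nonneg hX hY) hZ).eq_or_lt with h0 | hpos
  · have hX0 : X = 0 := by linarith
    have hY0 : Y = 0 := by linarith
    have hZ0 : Z = 0 := by linarith
    simp [hX0, hY0, hZ0, Real.zero_rpow (neg_ne_zero.2 hν.ne')]
  have hle : c * (X + Y + Z) ≤ c1 * X + c2 * Y + c3 * Z := by
    have h1 : c ≤ c1 := min_le_left _ _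
    have h2 : c ≤ c2 := (min_le_right _ _).trans (min_le_left _ _)
    have h3 : c ≤ c3 := (min_le_right _ _).trans (min_le_right _ _)
    rw [mul_add, mul_add]
    gcongr
  have hreal : (c1 * X + c2 * Y + c3 * Z) ^ (-ν) ≤ c ^ (-ν) * (X + Y + Z) ^ (-ν) := by
    rw [← Real.mul_rpow hcpos.le hpos.le]
    exact Real.rpow_le_rpow_of_nonpos (mul_pos hcpos hpos) hle (by linarith)
  refine (ENNReal.ofReal_le_ofReal hreal).trans ?_
  rw [ENNReal.ofReal_mul (by positivity), ← ENNReal.ofReal_rpow_of_pos hpos]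
  gcongr
  set N := ENNReal.ofReal (X + Y + Z) with hN
  have hN0 : N ≠ 0 := by simpa [hN] using hpos
  have hNt : N ≠ ⊤ := ENNReal.ofReal_ne_top
  have hNx : ENNReal.ofReal |x| ^ (q1 / ν) ≤ N := by
    rw [ENNReal.ofReal_rpow_of_nonneg (abs_nonneg _) (by positivity)]
    exact ENNReal.ofReal_le_ofReal (by linarith)
  have hNy : ENNReal.ofReal |y| ^ (q2 / ν) ≤ N := by
    rw [ENNReal.ofReal_rpow_of_nonneg (abs_nonneg _) (by positivity)]
    exact ENNReal.ofReal_le_ofReal (by linarith)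
  have hNz : ENNReal.ofReal |z| ^ (q3 / ν) ≤ N := by
    rw [ENNReal.ofReal_rpow_of_nonneg (abs_nonneg _) (by positivity)]
    exact ENNReal.ofReal_le_ofReal (by linarith)
  rcases le_or_gt 1 N with h | h
  · rw [ENNReal.rpow_neg_eq_mul_of_add_eq_one hN0 hNt ν hα]
    gcongr
    · exact rpow_neg_le_twoPowerKernel_of_one_le hν hα1 (by positivity) h hNx
    · exact rpow_neg_le_twoPowerKernel_of_one_le hν hα2 (by positivity) h hNy
    · exact rpow_neg_le_twoPowerKernel_of_one_le hν hα3 (by positivity) h hNz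
  · rw [ENNReal.rpow_neg_eq_mul_of_add_eq_one hN0 hNt ν hβ]
    gcongr
    · exact rpow_neg_le_twoPowerKernel_of_lt_one hν hq1 hβ1 h hNx
    · exact rpow_neg_le_twoPowerKernel_of_lt_one hν hq2 hβ2 h hNy
    · exact rpow_neg_le_twoPowerKernel_of_lt_one hν hq3 hβ3 h hNz

lemma ENNReal.add_sq_le (a b : ENNReal) : (a + b) ^ 2 ≤ 2 * (a ^ 2 + b ^ 2) := by
  have := ENNReal.rpow_add_le_mul_rpow_add_rpow a b (p := 2) (by norm_num)
  norm_num at this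
  exact this

lemma sq_lintegral_le {α : Type*} [MeasurableSpace α] (μ : Measure α) {f : α → ENNReal}
    (hf : AEMeasurable f μ) : (∫⁻ a, f a ∂μ) ^ 2 ≤ (∫⁻ a, f a ^ 2 ∂μ) * μ Set.univ := by
  have h := ENNReal.lintegral_mul_le_Lp_mul_Lq μ Real.HolderConjugate.two_two hf
    (aemeasurable_const (b := (1 : ENNReal)))
  simp only [Pi.mul_apply, mul_one, lintegral_const, ENNReal.rpow_two, one_pow,
    one_mul] at h
  calc _ ≤ ((∫⁻ a, f a ^ 2 ∂μ) ^ (1 / 2 : ℝ) * μ Set.univ ^ (1 / 2 : ℝ)) ^ 2 := by gcongr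
    _ = _ := by
      rw [mul_pow, ← ENNReal.rpow_natCast, ← ENNReal.rpow_natCast, ← ENNReal.rpow_mul,
        ← ENNReal.rpow_mul]
      norm_num

lemma lintegral_setLIntegral_sub {k : ℝ → ENNReal} (hk : Measurable k) (s : Set ℝ) :
    ∫⁻ u, ∫⁻ t in s, k (t - u) = (∫⁻ x, k x) * volume s := by
  rw [lintegral_lintegral_swap (by fun_prop)]
  simp [lintegral_sub_left_eq_self]

lemma lintegral_sq_setLIntegral_sub_lt_top_of_sq {k : ℝ → ENNReal} (hk : Measurable k)
    {s : Set ℝ} (hs : volume s ≠ ⊤) (h : ∫⁻ x, k x ^ 2 < ⊤) :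
    ∫⁻ u, (∫⁻ t in s, k (t - u)) ^ 2 < ⊤ := by
  calc _ ≤ ∫⁻ u, (∫⁻ t in s, k (t - u) ^ 2) * volume s := by
        gcongr with u
        refine (sq_lintegral_le _ (by fun_prop)).trans_eq ?_
        simp
    _ = (∫⁻ x, k x ^ 2) * volume s * volume s := by
        rw [lintegral_mul_const' _ _ hs, lintegral_setLIntegral_sub (k := fun x => k x ^ 2)
          (by fun_prop)]
    _ < ⊤ := ENNReal.mul_lt_top (ENNReal.mul_lt_top h hs.lt_top) hs.lt_top

lemma lintegral_sq_setLIntegral_sub_lt_top {k : ℝ → ENNReal} (hk : Measurable k)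
    {s : Set ℝ} (hs : volume s ≠ ⊤) (h : ∫⁻ x, k x < ⊤) :
    ∫⁻ u, (∫⁻ t in s, k (t - u)) ^ 2 < ⊤ := by
  calc _ ≤ ∫⁻ u, (∫⁻ t in s, k (t - u)) * ∫⁻ x, k x := by
        gcongr with u
        rw [sq]
        refine mul_le_mul' le_rfl ?_
        exact (setLIntegral_le_lintegral _ _).trans_eq (lintegral_sub_right_eq_self (μ := volume) k u)
    _ = (∫⁻ x, k x) * volume s * ∫⁻ x, k x := by
        rw [lintegral_mul_const' _ _ h.ne, lintegral_setLIntegral_sub hk]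
    _ < ⊤ := ENNReal.mul_lt_top (ENNReal.mul_lt_top h hs.lt_top) h

lemma lintegral_sq_setLIntegral_twoPowerKernel_lt_top {p r : ℝ} (hp : p < 1) (hr : 1 < 2 * r)
    {s : Set ℝ} (hs : volume s ≠ ⊤) :
    ∫⁻ u, (∫⁻ t in s, twoPowerKernel p r (t - u)) ^ 2 < ⊤ := by
  have m1 := measurable_twoPowerKernel p 2
  have m2 := measurable_twoPowerKernel 0 r
  have h1 := lintegral_sq_setLIntegral_sub_lt_top m1 hs
    (lintegral_twoPowerKernel_lt_top hp one_lt_two)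
  have h2 := lintegral_sq_setLIntegral_sub_lt_top_of_sq m2 hs (by
    simp only [twoPowerKernel_sq]
    exact lintegral_twoPowerKernel_lt_top (by norm_num) hr)
  have m1' : Measurable fun u => ∫⁻ t in s, twoPowerKernel p 2 (t - u) :=
    Measurable.lintegral_prod_right' (f := fun z : ℝ × ℝ => twoPowerKernel p 2 (z.2 - z.1))
      (by fun_prop)
  calc _ ≤ ∫⁻ u, 2 * ((∫⁻ t in s, twoPowerKernel p 2 (t - u)) ^ 2 +
          (∫⁻ t in s, twoPowerKernel 0 r (t - u)) ^ 2) := by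
        gcongr with u
        refine le_trans ?_ (ENNReal.add_sq_le _ _)
        rw [← lintegral_add_left (by fun_prop)]
        gcongr
        exact twoPowerKernel_le_add _ _ _ _ _
    _ < ⊤ := by
        rw [lintegral_const_mul' _ _ (by simp), lintegral_add_left (by fun_prop)]
        exact ENNReal.mul_lt_top (by simp) (ENNReal.add_lt_top.2 ⟨h1, h2⟩)

lemma lintegral_sq_twoPowerKernel_lt_top {p r : ℝ} (hp : 2 * p < 1) (hr : 1 < 2 * r) :
    ∫⁻ x, twoPowerKernel p r x ^ 2 < ⊤ := by
  simp only [twoPowerKernel_sq]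
  exact lintegral_twoPowerKernel_lt_top hp hr

lemma lintegral_sq_setLIntegral_sum_rpow_neg_lt_top
    {q1 q2 q3 c1 c2 c3 ν α1 α2 α3 β1 β2 β3 : ℝ}
    (hq1 : 0 < q1) (hq2 : 0 < q2) (hq3 : 0 < q3)
    (hc1 : 0 < c1) (hc2 : 0 < c2) (hc3 : 0 < c3) (hν : 0 < ν)
    (hα1 : 1 < 2 * (q1 * α1)) (hα2 : 1 < 2 * (q2 * α2)) (hα3 : 1 < 2 * (q3 * α3))
    (hα : α1 + α2 + α3 = 1) (hβ1 : 0 ≤ β1) (hβ2 : 0 ≤ β2) (hβ3 : 0 ≤ β3)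
    (hβ1' : 2 * (q1 * β1) < 1) (hβ2' : 2 * (q2 * β2) < 1) (hβ3' : q3 * β3 < 1)
    (hβ : β1 + β2 + β3 = 1) {s : Set ℝ} (hs : volume s ≠ ⊤) :
    (∫⁻ u : ℝ × ℝ × ℝ,
      (∫⁻ t in s,
        ENNReal.ofReal ((c1 * |u.1| ^ (q1 / ν) + c2 * |u.2.1| ^ (q2 / ν) +
          c3 * |t - u.2.2| ^ (q3 / ν)) ^ (-ν))) ^ 2) < ⊤ := by
  have hα1' : 0 ≤ α1 := (pos_of_mul_pos_right (by linarith : 0 < q1 * α1) hq1.le).le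
  have hα2' : 0 ≤ α2 := (pos_of_mul_pos_right (by linarith : 0 < q2 * α2) hq2.le).le
  have hα3' : 0 ≤ α3 := (pos_of_mul_pos_right (by linarith : 0 < q3 * α3) hq3.le).le
  set C := ENNReal.ofReal (min c1 (min c2 c3) ^ (-ν)) with hC
  set f := twoPowerKernel (q1 * β1) (q1 * α1) with hf
  set g := twoPowerKernel (q2 * β2) (q2 * α2) with hg
  set k := twoPowerKernel (q3 * β3) (q3 * α3) with hk
  have mf : Measurable f := measurable_twoPowerKernel _ _
  have mg : Measurable g := measurable_twoPowerKernel _ _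
  have mk : Measurable k := measurable_twoPowerKernel _ _
  have mF : Measurable fun u => ∫⁻ t in s, k (t - u) :=
    Measurable.lintegral_prod_right' (f := fun z : ℝ × ℝ => k (z.2 - z.1)) (by fun_prop)
  calc _ ≤ ∫⁻ u : ℝ × ℝ × ℝ,
          C ^ 2 * (f u.1 ^ 2 * (g u.2.1 ^ 2 * (∫⁻ t in s, k (t - u.2.2)) ^ 2)) := by
        gcongr with u
        rw [← mul_pow, ← mul_pow, ← mul_pow]
        gcongr
        rw [← lintegral_const_mul _ (by fun_prop), ← lintegral_const_mul _ (by fun_prop),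
          ← lintegral_const_mul _ (by fun_prop)]
        gcongr with t
        exact ofReal_sum_rpow_neg_le hq1 hq2 hq3 hc1 hc2 hc3 hν hα1' hα2' hα3' hα hβ1 hβ2 hβ3 hβ
          _ _ _
    _ = C ^ 2 * ((∫⁻ x, f x ^ 2) * ((∫⁻ y, g y ^ 2) *
          ∫⁻ z, (∫⁻ t in s, k (t - z)) ^ 2)) := by
        rw [lintegral_const_mul' _ _ (by simp [hC]), Measure.volume_eq_prod,
          lintegral_prod_mul (f := fun x => f x ^ 2)
            (g := fun v : ℝ × ℝ => g v.1 ^ 2 * (∫⁻ t in s, k (t - v.2)) ^ 2)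
            (by fun_prop) (by fun_prop), Measure.volume_eq_prod,
          lintegral_prod_mul (f := fun y => g y ^ 2)
            (g := fun z => (∫⁻ t in s, k (t - z)) ^ 2) (by fun_prop) (by fun_prop)]
    _ < ⊤ := ENNReal.mul_lt_top (by simp [hC])
        (ENNReal.mul_lt_top (lintegral_sq_twoPowerKernel_lt_top hβ1' hα1)
          (ENNReal.mul_lt_top (lintegral_sq_twoPowerKernel_lt_top hβ2' hα2)
            (lintegral_sq_setLIntegral_twoPowerKernel_lt_top hβ3' hα3 hs)))

theorem stmt_14 (q1 q2 q3 c1 c2 c3 ν x3 : ℝ)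
    (hq1 : 0 < q1) (hq2 : 0 < q2) (hq3 : 0 < q3)
    (hc1 : 0 < c1) (hc2 : 0 < c2) (hc3 : 0 < c3) (hν : 0 < ν)
    (hx3 : 0 < x3)
    (hlow : 1 / (2 * q1) + 1 / (2 * q2) + 1 / (2 * q3) < 1)
    (hup : 1 < 1 / (2 * q1) + 1 / (2 * q2) + 1 / q3) :
    (∫⁻ u : ℝ × ℝ × ℝ,
      (∫⁻ t in Set.Ioc (0 : ℝ) x3,
        ENNReal.ofReal ((c1 * |u.1| ^ (q1 / ν) + c2 * |u.2.1| ^ (q2 / ν) +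
          c3 * |t - u.2.2| ^ (q3 / ν)) ^ (-ν))) ^ 2) < ⊤ := by
  obtain ⟨ε, hε⟩ : ∃ ε, ε = (1 - (1 / (2 * q1) + 1 / (2 * q2) + 1 / (2 * q3))) / 3 := ⟨_, rfl⟩
  obtain ⟨B, hB⟩ : ∃ B, B = 1 / (2 * q1) + 1 / (2 * q2) + 1 / q3 := ⟨_, rfl⟩
  have hε0 : 0 < ε := by rw [hε]; linarith
  have hB1 : 1 < B := hB ▸ hup
  have hB0 : 0 < B := one_pos.trans hB1
  have hBinv : 1 / B < 1 := (div_lt_one hB0).2 hB1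
  have hα {q : ℝ} (hq : 0 < q) : 1 < 2 * (q * (1 / (2 * q) + ε)) := by
    have : 2 * (q * (1 / (2 * q) + ε)) = 1 + 2 * (q * ε) := by field_simp
    rw [this]
    have := mul_pos hq hε0
    linarith
  have hβ {q : ℝ} (hq : 0 < q) : 2 * (q * (1 / (2 * q) / B)) < 1 := by
    refine lt_of_eq_of_lt ?_ hBinv
    field_simp
  have hβ' : q3 * (1 / q3 / B) < 1 := by
    refine lt_of_eq_of_lt ?_ hBinv
    field_simp
  refine lintegral_sq_setLIntegral_sum_rpow_neg_lt_top hq1 hq2 hq3 hc1 hc2 hc3 hν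
    (hα hq1) (hα hq2) (hα hq3) ?_ (by positivity) (by positivity) (by positivity)
    (hβ hq1) (hβ hq2) hβ' ?_ (by simp)
  · rw [hε]; ring
  · rw [← add_div, ← add_div, ← hB, div_self hB0.ne']
end

section
/- Assume 1/(2q1) + 1/(2q2) + 1/q3 < 1 < Q. Fix x1, x2, x3 > 0 and define f12(u1,u2,u3) := 1(0 < u3 < x3) · ∫_0^{x1} ∫_0^{x2} ∫_ℝ (c1·|t1−u1|^{q1/ν} + c2·|t2−u2|^{q2/ν} + c3·|t3|^{q3/ν})^{−ν} dt1 dt2 dt3. Then ∫_{ℝ³} f12(u)² du < ∞, i.e. the Gaussian random field 𝒴₁₂ of the paper is well defined. -/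
open MeasureTheory
open scoped ENNReal

/-- The mass that the translate by `u` of the density `φ` gives to the window `(0, x]`. -/
noncomputable def windowMass (x : ℝ) (φ : ℝ → ℝ≥0∞) (u : ℝ) : ℝ≥0∞ :=
  ∫⁻ t in Set.Ioc (0 : ℝ) x, φ (t - u)

/-- The power `|t| ^ (-α)`, restricted to `|t| ≤ 1` (`far = false`) or to `1 < |t|`
(`far = true`). -/
noncomputable def powerPiece (far : Bool) (α t : ℝ) : ℝ≥0∞ :=
  {t : ℝ | 1 < |t| ↔ far = true}.indicator (fun t => ENNReal.ofReal (|t| ^ (-α))) t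

theorem measurable_windowMass (x : ℝ) {φ : ℝ → ℝ≥0∞} (hφ : Measurable φ) :
    Measurable (windowMass x φ) := by
  unfold windowMass
  exact Measurable.lintegral_prod_right' (f := fun p : ℝ × ℝ => φ (p.2 - p.1)) (by fun_prop)

theorem lintegral_windowMass (x : ℝ) {φ : ℝ → ℝ≥0∞} (hφ : Measurable φ) :
    ∫⁻ u, windowMass x φ u = (∫⁻ t, φ t) * ENNReal.ofReal x := by
  unfold windowMass
  rw [lintegral_lintegral_swap (by fun_prop)]
  simp_rw [lintegral_sub_left_eq_self φ]
  simp

theorem lintegral_windowMass_sq_lt_top_of_lintegral_lt_top (x : ℝ) {φ : ℝ → ℝ≥0∞}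
    (hφ : Measurable φ) (hfin : ∫⁻ t, φ t < ⊤) : ∫⁻ u, windowMass x φ u ^ 2 < ⊤ := by
  calc ∫⁻ u, windowMass x φ u ^ 2
      ≤ ∫⁻ u, (∫⁻ t, φ t) * windowMass x φ u := by
        refine lintegral_mono fun u => ?_
        rw [sq]
        gcongr
        refine (setLIntegral_le_lintegral _ _).trans ?_
        rw [lintegral_sub_right_eq_self φ]
    _ = (∫⁻ t, φ t) * ((∫⁻ t, φ t) * ENNReal.ofReal x) := by
        rw [lintegral_const_mul _ (measurable_windowMass x hφ), lintegral_windowMass x hφ]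
    _ < ⊤ := ENNReal.mul_lt_top hfin (ENNReal.mul_lt_top hfin ENNReal.ofReal_lt_top)

theorem sq_windowMass_le (x : ℝ) {φ : ℝ → ℝ≥0∞} (hφ : Measurable φ) (u : ℝ) :
    windowMass x φ u ^ 2 ≤ ENNReal.ofReal x * windowMass x (fun t => φ t ^ 2) u := by
  have h := ENNReal.lintegral_mul_le_Lp_mul_Lq (volume.restrict (Set.Ioc (0 : ℝ) x))
    Real.HolderConjugate.two_two (f := fun _ => 1) (g := fun t => φ (t - u))
    (by fun_prop) (by fun_prop)
  simp only [Pi.mul_apply, one_mul, lintegral_const, Measure.restrict_apply, MeasurableSet.univ,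
    Set.univ_inter, Real.volume_Ioc, sub_zero, ENNReal.rpow_two, one_pow] at h
  have hsqrt : ∀ a : ℝ≥0∞, (a ^ (1 / 2 : ℝ)) ^ 2 = a := fun a => by
    rw [← ENNReal.rpow_two, ← ENNReal.rpow_mul]
    norm_num
  have h2 := pow_le_pow_left' h 2
  rwa [mul_pow, hsqrt, hsqrt] at h2

theorem lintegral_windowMass_sq_lt_top_of_lintegral_sq_lt_top (x : ℝ) {φ : ℝ → ℝ≥0∞}
    (hφ : Measurable φ) (hfin : ∫⁻ t, φ t ^ 2 < ⊤) : ∫⁻ u, windowMass x φ u ^ 2 < ⊤ := by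
  have hφ2 : Measurable fun t => φ t ^ 2 := by fun_prop
  refine (lintegral_mono fun u => sq_windowMass_le x hφ u).trans_lt ?_
  rw [lintegral_const_mul _ (measurable_windowMass x hφ2), lintegral_windowMass x hφ2]
  exact ENNReal.mul_lt_top ENNReal.ofReal_lt_top (ENNReal.mul_lt_top hfin ENNReal.ofReal_lt_top)

theorem measurable_powerPiece (far : Bool) (α : ℝ) : Measurable (powerPiece far α) := by
  unfold powerPiece
  refine Measurable.indicator (by fun_prop) ?_
  have h : MeasurableSet {t : ℝ | 1 < |t|} := measurableSet_lt (by fun_prop) (by fun_prop)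
  cases far
  · convert h.compl using 1
    ext t
    simp
  · simpa using h

theorem powerPiece_sq (far : Bool) (α t : ℝ) :
    powerPiece far α t ^ 2 = powerPiece far (2 * α) t := by
  unfold powerPiece
  simp only [Set.indicator_apply]
  split_ifs
  · rw [← ENNReal.ofReal_pow (by positivity), ← Real.rpow_mul_natCast (abs_nonneg t)]
    congr 2
    push_cast
    ring
  · simp

theorem lintegral_comp_abs (F : ℝ → ℝ≥0∞) :
    ∫⁻ t, F |t| = 2 * ∫⁻ t in Set.Ioi (0 : ℝ), F t := by
  have hpos : ∫⁻ t in Set.Ioi (0 : ℝ), F |t| = ∫⁻ t in Set.Ioi (0 : ℝ), F t :=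
    setLIntegral_congr_fun measurableSet_Ioi fun t ht => by
      simp only [abs_of_pos (Set.mem_Ioi.1 ht)]
  have hneg : ∫⁻ t in Set.Iio (0 : ℝ), F |t| = ∫⁻ t in Set.Ioi (0 : ℝ), F |t| := by
    have h := (Measure.measurePreserving_neg (volume : Measure ℝ)).setLIntegral_comp_preimage_emb
      (MeasurableEquiv.neg ℝ).measurableEmbedding (fun t => F |t|) (Set.Ioi 0)
    simpa using h
  rw [← lintegral_add_compl (fun t => F |t|) (measurableSet_Ioi (a := (0 : ℝ))), Set.compl_Ioi,
    setLIntegral_congr Iio_ae_eq_Iic.symm, hneg, hpos, two_mul]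

theorem lintegral_powerPiece_lt_top {far : Bool} {α : ℝ}
    (h : bif far then 1 < α else α < 1) : ∫⁻ t, powerPiece far α t < ⊤ := by
  have habs : ∀ t, powerPiece far α t = powerPiece far α |t| := fun t => by
    simp [powerPiece, Set.indicator_apply]
  rw [lintegral_congr habs, lintegral_comp_abs (powerPiece far α)]
  refine ENNReal.mul_lt_top (by simp) ?_
  cases far
  · have hint : IntegrableOn (fun t : ℝ => t ^ (-α)) (Set.Ioc 0 1) := by
      rw [← intervalIntegrable_iff_integrableOn_Ioc_of_le zero_le_one]
      exact intervalIntegral.intervalIntegrable_rpow' (by simp at h; linarith)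
    refine lt_of_le_of_lt ?_ hint.lintegral_lt_top
    rw [← lintegral_indicator measurableSet_Ioi, ← lintegral_indicator measurableSet_Ioc]
    refine lintegral_mono fun t => ?_
    simp only [powerPiece, Set.indicator_apply, Set.mem_Ioi, Set.mem_Ioc, Set.mem_ofPred_eq]
    by_cases h0 : 0 < t
    · simp [h0, abs_of_pos h0]
    · simp [h0]
  · have hint : IntegrableOn (fun t : ℝ => t ^ (-α)) (Set.Ioi 1) :=
      integrableOn_Ioi_rpow_of_lt (by simp at h; linarith) one_pos
    refine lt_of_le_of_lt ?_ hint.lintegral_lt_top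
    rw [← lintegral_indicator measurableSet_Ioi, ← lintegral_indicator measurableSet_Ioi]
    refine lintegral_mono fun t => ?_
    simp only [powerPiece, Set.indicator_apply, Set.mem_Ioi, Set.mem_ofPred_eq]
    by_cases h0 : 0 < t
    · simp [h0, abs_of_pos h0]
    · simp [h0]

theorem lintegral_windowMass_powerPiece_sq_lt_top (x : ℝ) {far : Bool} {α : ℝ}
    (h : bif far then 1 / 2 < α else α < 1) :
    ∫⁻ u, windowMass x (powerPiece far α) u ^ 2 < ⊤ := by
  cases far
  · exact lintegral_windowMass_sq_lt_top_of_lintegral_lt_top x (measurable_powerPiece _ _)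
      (lintegral_powerPiece_lt_top h)
  · refine lintegral_windowMass_sq_lt_top_of_lintegral_sq_lt_top x (measurable_powerPiece _ _) ?_
    simp_rw [powerPiece_sq]
    exact lintegral_powerPiece_lt_top (by simp at h ⊢; linarith)

/-- Convex weights lying below `r i` at the near coordinates and above `a i` at the far ones. -/
theorem exists_convex_weights {a₁ a₂ a₃ r₁ r₂ r₃ : ℝ} (ha₁ : 0 < a₁) (ha₂ : 0 < a₂)
    (ha₃ : 0 < a₃) (hr₁ : 0 < r₁) (hr₂ : 0 < r₂) (hr₃ : 0 < r₃) (ha : a₁ + a₂ + a₃ < 1)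
    (hr : 1 < r₁ + r₂ + r₃) (b₁ b₂ b₃ : Bool) :
    ∃ w₁ w₂ w₃ : ℝ, 0 ≤ w₁ ∧ 0 ≤ w₂ ∧ 0 ≤ w₃ ∧ w₁ + w₂ + w₃ = 1 ∧
      (bif b₁ then a₁ < w₁ else w₁ < r₁) ∧ (bif b₂ then a₂ < w₂ else w₂ < r₂) ∧
      (bif b₃ then a₃ < w₃ else w₃ < r₃) := by
  set δ := (1 - a₁ - a₂ - a₃) / 3 with hδ
  cases b₁ <;> cases b₂ <;> cases b₃
  · have hR : 0 < r₁ + r₂ + r₃ := by linarith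
    refine ⟨r₁ / (r₁ + r₂ + r₃), r₂ / (r₁ + r₂ + r₃), r₃ / (r₁ + r₂ + r₃), by positivity,
      by positivity, by positivity, by field_simp, ?_, ?_, ?_⟩ <;>
    exact div_lt_self (by assumption) hr
  · exact ⟨0, 0, 1, by simp; grind⟩
  · exact ⟨0, 1, 0, by simp; grind⟩
  · exact ⟨0, a₂ + δ, 1 - a₂ - δ, by simp; grind⟩
  · exact ⟨1, 0, 0, by simp; grind⟩
  · exact ⟨a₁ + δ, 0, 1 - a₁ - δ, by simp; grind⟩
  · exact ⟨a₁ + δ, 1 - a₁ - δ, 0, by simp; grind⟩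
  · exact ⟨a₁ + δ, a₂ + δ, a₃ + δ, by simp; grind⟩

theorem add_rpow_neg_le_prod_rpow {w₁ w₂ w₃ p₁ p₂ p₃ ν : ℝ} (hν : 0 ≤ ν) (hw₁ : 0 ≤ w₁)
    (hw₂ : 0 ≤ w₂) (hw₃ : 0 ≤ w₃) (hw : w₁ + w₂ + w₃ = 1) (hp₁ : 0 < p₁) (hp₂ : 0 < p₂)
    (hp₃ : 0 < p₃) :
    (p₁ + p₂ + p₃) ^ (-ν) ≤ p₁ ^ (-(w₁ * ν)) * p₂ ^ (-(w₂ * ν)) * p₃ ^ (-(w₃ * ν)) := by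
  have h : p₁ ^ w₁ * p₂ ^ w₂ * p₃ ^ w₃ ≤ p₁ + p₂ + p₃ :=
    (Real.geom_mean_le_arith_mean3_weighted hw₁ hw₂ hw₃ hp₁.le hp₂.le hp₃.le hw).trans <| by
      nlinarith [mul_nonneg (by linarith : 0 ≤ 1 - w₁) hp₁.le,
        mul_nonneg (by linarith : 0 ≤ 1 - w₂) hp₂.le, mul_nonneg (by linarith : 0 ≤ 1 - w₃) hp₃.le]
  refine (Real.rpow_le_rpow_of_nonpos (by positivity) h (by linarith)).trans_eq ?_
  rw [Real.mul_rpow (by positivity) (by positivity), Real.mul_rpow (by positivity) (by positivity),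
    ← Real.rpow_mul hp₁.le, ← Real.rpow_mul hp₂.le, ← Real.rpow_mul hp₃.le]
  simp only [mul_neg]

theorem mul_abs_rpow_rpow {c q ν w t : ℝ} (hc : 0 < c) (hν : 0 < ν) :
    (c * |t| ^ (q / ν)) ^ (-(w * ν)) = c ^ (-(w * ν)) * |t| ^ (-(w * q)) := by
  rw [Real.mul_rpow hc.le (by positivity), ← Real.rpow_mul (abs_nonneg t)]
  congr 2
  field_simp

theorem kernel_le_mul_powerPiece {q₁ q₂ q₃ c₁ c₂ c₃ ν w₁ w₂ w₃ t₁ t₂ t₃ : ℝ}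
    (hc₁ : 0 < c₁) (hc₂ : 0 < c₂) (hc₃ : 0 < c₃) (hν : 0 < ν) (hw₁ : 0 ≤ w₁)
    (hw₂ : 0 ≤ w₂) (hw₃ : 0 ≤ w₃) (hw : w₁ + w₂ + w₃ = 1) (ht₁ : t₁ ≠ 0) (ht₂ : t₂ ≠ 0)
    (ht₃ : t₃ ≠ 0) {b₁ b₂ b₃ : Bool} (hb₁ : 1 < |t₁| ↔ b₁ = true) (hb₂ : 1 < |t₂| ↔ b₂ = true)
    (hb₃ : 1 < |t₃| ↔ b₃ = true) :
    ENNReal.ofReal ((c₁ * |t₁| ^ (q₁ / ν) + c₂ * |t₂| ^ (q₂ / ν) + c₃ * |t₃| ^ (q₃ / ν)) ^ (-ν)) ≤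
      ENNReal.ofReal (c₁ ^ (-(w₁ * ν)) * c₂ ^ (-(w₂ * ν)) * c₃ ^ (-(w₃ * ν))) *
        (powerPiece b₁ (w₁ * q₁) t₁ * (powerPiece b₂ (w₂ * q₂) t₂ *
          powerPiece b₃ (w₃ * q₃) t₃)) := by
  have h := add_rpow_neg_le_prod_rpow hν.le hw₁ hw₂ hw₃ hw
    (p₁ := c₁ * |t₁| ^ (q₁ / ν)) (p₂ := c₂ * |t₂| ^ (q₂ / ν)) (p₃ := c₃ * |t₃| ^ (q₃ / ν))
    (by positivity) (by positivity) (by positivity)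
  rw [mul_abs_rpow_rpow hc₁ hν, mul_abs_rpow_rpow hc₂ hν, mul_abs_rpow_rpow hc₃ hν] at h
  simp only [powerPiece]
  rw [Set.indicator_of_mem (show t₁ ∈ {t : ℝ | 1 < |t| ↔ b₁ = true} from hb₁),
    Set.indicator_of_mem (show t₂ ∈ {t : ℝ | 1 < |t| ↔ b₂ = true} from hb₂),
    Set.indicator_of_mem (show t₃ ∈ {t : ℝ | 1 < |t| ↔ b₃ = true} from hb₃),
    ← ENNReal.ofReal_mul (by positivity), ← ENNReal.ofReal_mul (by positivity),
    ← ENNReal.ofReal_mul (by positivity)]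
  refine ENNReal.ofReal_le_ofReal (h.trans_eq ?_)
  ring

theorem lintegral_window_prod (x₁ x₂ u₁ u₂ : ℝ) {φ₁ φ₂ φ₃ : ℝ → ℝ≥0∞} (C : ℝ≥0∞)
    (h₁ : Measurable φ₁) (h₂ : Measurable φ₂) (h₃ : Measurable φ₃) :
    (∫⁻ t₁ in Set.Ioc (0 : ℝ) x₁, ∫⁻ t₂ in Set.Ioc (0 : ℝ) x₂, ∫⁻ t₃ : ℝ,
      C * (φ₁ (t₁ - u₁) * (φ₂ (t₂ - u₂) * φ₃ t₃))) =
      C * (windowMass x₁ φ₁ u₁ * (windowMass x₂ φ₂ u₂ * ∫⁻ t, φ₃ t)) := by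
  have e₃ : ∀ t₁ t₂, ∫⁻ t₃ : ℝ, C * (φ₁ (t₁ - u₁) * (φ₂ (t₂ - u₂) * φ₃ t₃)) =
      C * (φ₁ (t₁ - u₁) * (φ₂ (t₂ - u₂) * ∫⁻ t, φ₃ t)) := fun t₁ t₂ => by
    rw [lintegral_const_mul _ (by fun_prop), lintegral_const_mul _ (by fun_prop),
      lintegral_const_mul _ h₃]
  simp_rw [e₃]
  have e₂ : ∀ t₁, ∫⁻ t₂ in Set.Ioc (0 : ℝ) x₂,
      C * (φ₁ (t₁ - u₁) * (φ₂ (t₂ - u₂) * ∫⁻ t, φ₃ t)) =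
      C * (φ₁ (t₁ - u₁) * (windowMass x₂ φ₂ u₂ * ∫⁻ t, φ₃ t)) := fun t₁ => by
    rw [lintegral_const_mul _ (by fun_prop), lintegral_const_mul _ (by fun_prop),
      lintegral_mul_const _ (by fun_prop)]
    rfl
  simp_rw [e₂]
  rw [lintegral_const_mul _ (by fun_prop), lintegral_mul_const _ (by fun_prop)]
  rfl

theorem lintegral_sq_slab_prod_lt_top {ψ₁ ψ₂ : ℝ → ℝ≥0∞} (h₁ : Measurable ψ₁)
    (h₂ : Measurable ψ₂) (hfin₁ : ∫⁻ u, ψ₁ u ^ 2 < ⊤) (hfin₂ : ∫⁻ u, ψ₂ u ^ 2 < ⊤) (x : ℝ)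
    {C K : ℝ≥0∞} (hC : C < ⊤) (hK : K < ⊤) :
    ∫⁻ u : ℝ × ℝ × ℝ, ({u : ℝ × ℝ × ℝ | 0 < u.2.2 ∧ u.2.2 < x}.indicator
      (fun u => C * (ψ₁ u.1 * (ψ₂ u.2.1 * K))) u) ^ 2 < ⊤ := by
  have e : ∀ u : ℝ × ℝ × ℝ, ({u : ℝ × ℝ × ℝ | 0 < u.2.2 ∧ u.2.2 < x}.indicator
      (fun u => C * (ψ₁ u.1 * (ψ₂ u.2.1 * K))) u) ^ 2 =
      ψ₁ u.1 ^ 2 * (ψ₂ u.2.1 ^ 2 *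
        (Set.Ioo 0 x).indicator (fun _ => (C * K) ^ 2) u.2.2) := fun u => by
    simp only [Set.indicator_apply, Set.mem_ofPred_eq, Set.mem_Ioo]
    split_ifs
    · ring
    · simp
  have hm : Measurable ((Set.Ioo 0 x).indicator fun _ => (C * K) ^ 2) :=
    measurable_const.indicator measurableSet_Ioo
  simp_rw [e]
  rw [Measure.volume_eq_prod, lintegral_prod_mul (f := fun a => ψ₁ a ^ 2)
      (g := fun b : ℝ × ℝ => ψ₂ b.1 ^ 2 * (Set.Ioo 0 x).indicator (fun _ => (C * K) ^ 2) b.2)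
      (by fun_prop) (by fun_prop),
    Measure.volume_eq_prod, lintegral_prod_mul (f := fun a => ψ₂ a ^ 2) (by fun_prop)
      (by fun_prop), lintegral_indicator measurableSet_Ioo]
  refine ENNReal.mul_lt_top hfin₁ (ENNReal.mul_lt_top hfin₂ ?_)
  simp only [lintegral_const, Measure.restrict_apply, MeasurableSet.univ, Set.univ_inter,
    Real.volume_Ioo]
  exact ENNReal.mul_lt_top (ENNReal.pow_lt_top (ENNReal.mul_lt_top hC hK)) ENNReal.ofReal_lt_top


theorem stmt_15 (q1 q2 q3 c1 c2 c3 ν x1 x2 x3 : ℝ)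
    (hq1 : 0 < q1) (hq2 : 0 < q2) (hq3 : 0 < q3)
    (hc1 : 0 < c1) (hc2 : 0 < c2) (hc3 : 0 < c3) (hν : 0 < ν)
    (hx1 : 0 < x1) (hx2 : 0 < x2) (hx3 : 0 < x3)
    (hlow : 1 / (2 * q1) + 1 / (2 * q2) + 1 / q3 < 1)
    (hup : 1 < 1 / q1 + 1 / q2 + 1 / q3) :
    (∫⁻ u : ℝ × ℝ × ℝ,
      ({u : ℝ × ℝ × ℝ | 0 < u.2.2 ∧ u.2.2 < x3}.indicator
        (fun u => ∫⁻ t1 in Set.Ioc (0 : ℝ) x1, ∫⁻ t2 in Set.Ioc (0 : ℝ) x2, ∫⁻ t3 : ℝ,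
          ENNReal.ofReal ((c1 * |t1 - u.1| ^ (q1 / ν) + c2 * |t2 - u.2.1| ^ (q2 / ν) +
            c3 * |t3| ^ (q3 / ν)) ^ (-ν))) u) ^ 2) < ⊤ := by
  have key : ∀ b : Bool × Bool × Bool, ∃ w₁ w₂ w₃ : ℝ, 0 ≤ w₁ ∧ 0 ≤ w₂ ∧ 0 ≤ w₃ ∧
      w₁ + w₂ + w₃ = 1 ∧ (bif b.1 then 1 / 2 < w₁ * q1 else w₁ * q1 < 1) ∧
      (bif b.2.1 then 1 / 2 < w₂ * q2 else w₂ * q2 < 1) ∧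
      (bif b.2.2 then 1 < w₃ * q3 else w₃ * q3 < 1) := by
    rintro ⟨b₁, b₂, b₃⟩
    obtain ⟨w₁, w₂, w₃, hw₁, hw₂, hw₃, hw, h₁, h₂, h₃⟩ :=
      exists_convex_weights (a₁ := 1 / (2 * q1)) (a₂ := 1 / (2 * q2)) (a₃ := 1 / q3)
        (r₁ := 1 / q1) (r₂ := 1 / q2) (r₃ := 1 / q3) (by positivity) (by positivity)
        (by positivity) (by positivity) (by positivity) (by positivity) hlow hup b₁ b₂ b₃
    refine ⟨w₁, w₂, w₃, hw₁, hw₂, hw₃, hw, ?_, ?_, ?_⟩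
    · cases b₁ <;> simp only [cond_true, cond_false] at h₁ ⊢
      · rwa [lt_div_iff₀ hq1] at h₁
      · rw [div_lt_iff₀ (by positivity)] at h₁; linarith
    · cases b₂ <;> simp only [cond_true, cond_false] at h₂ ⊢
      · rwa [lt_div_iff₀ hq2] at h₂
      · rw [div_lt_iff₀ (by positivity)] at h₂; linarith
    · cases b₃ <;> simp only [cond_true, cond_false] at h₃ ⊢
      · rwa [lt_div_iff₀ hq3] at h₃
      · rwa [div_lt_iff₀ hq3] at h₃
  choose w₁ w₂ w₃ hw₁ hw₂ hw₃ hw h₁ h₂ h₃ using key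
  set C : Bool × Bool × Bool → ℝ≥0∞ := fun b =>
    ENNReal.ofReal (c1 ^ (-(w₁ b * ν)) * c2 ^ (-(w₂ b * ν)) * c3 ^ (-(w₃ b * ν)))
  set φ₁ : Bool × Bool × Bool → ℝ → ℝ≥0∞ := fun b => powerPiece b.1 (w₁ b * q1)
  set φ₂ : Bool × Bool × Bool → ℝ → ℝ≥0∞ := fun b => powerPiece b.2.1 (w₂ b * q2)
  set φ₃ : Bool × Bool × Bool → ℝ → ℝ≥0∞ := fun b => powerPiece b.2.2 (w₃ b * q3)
  have hm₁ : ∀ b, Measurable (φ₁ b) := fun b => measurable_powerPiece _ _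
  have hm₂ : ∀ b, Measurable (φ₂ b) := fun b => measurable_powerPiece _ _
  have hm₃ : ∀ b, Measurable (φ₃ b) := fun b => measurable_powerPiece _ _
  have hne : ∀ u : ℝ, ∀ᵐ t : ℝ, t - u ≠ 0 := fun u => by
    filter_upwards [compl_mem_ae_iff.2 (measure_singleton u)] with t ht
    exact sub_ne_zero.2 ht
  have hbound : ∀ u₁ u₂ : ℝ,
      (∫⁻ t1 in Set.Ioc (0 : ℝ) x1, ∫⁻ t2 in Set.Ioc (0 : ℝ) x2, ∫⁻ t3 : ℝ,
        ENNReal.ofReal ((c1 * |t1 - u₁| ^ (q1 / ν) + c2 * |t2 - u₂| ^ (q2 / ν) +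
          c3 * |t3| ^ (q3 / ν)) ^ (-ν))) ≤
      ∑ b, C b * (windowMass x1 (φ₁ b) u₁ * (windowMass x2 (φ₂ b) u₂ * ∫⁻ t, φ₃ b t)) := by
    intro u₁ u₂
    simp_rw [← lintegral_window_prod x1 x2 u₁ u₂ (C _) (hm₁ _) (hm₂ _) (hm₃ _)]
    rw [← lintegral_finsetSum']
    swap
    · intro b _
      fun_prop
    refine lintegral_mono_ae ?_
    filter_upwards [ae_restrict_of_ae (hne u₁)] with t₁ ht₁
    rw [← lintegral_finsetSum']
    swap
    · intro b _
      fun_prop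
    refine lintegral_mono_ae ?_
    filter_upwards [ae_restrict_of_ae (hne u₂)] with t₂ ht₂
    rw [← lintegral_finsetSum']
    swap
    · intro b _
      fun_prop
    refine lintegral_mono_ae ?_
    filter_upwards [hne 0] with t₃ ht₃
    rw [sub_zero] at ht₃
    let b : Bool × Bool × Bool :=
      (decide (1 < |t₁ - u₁|), decide (1 < |t₂ - u₂|), decide (1 < |t₃|))
    refine le_trans ?_ (Finset.single_le_sum (fun _ _ => zero_le) (Finset.mem_univ b))
    exact kernel_le_mul_powerPiece hc1 hc2 hc3 hν (hw₁ b) (hw₂ b) (hw₃ b) (hw b) ht₁ ht₂ ht₃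
      (by simp [b]) (by simp [b]) (by simp [b])
  have hfin : ∀ b, ∫⁻ u : ℝ × ℝ × ℝ, ({u : ℝ × ℝ × ℝ | 0 < u.2.2 ∧ u.2.2 < x3}.indicator
      (fun u => C b * (windowMass x1 (φ₁ b) u.1 *
        (windowMass x2 (φ₂ b) u.2.1 * ∫⁻ t, φ₃ b t))) u) ^ 2 < ⊤ := fun b =>
    lintegral_sq_slab_prod_lt_top (measurable_windowMass _ (hm₁ b))
      (measurable_windowMass _ (hm₂ b)) (lintegral_windowMass_powerPiece_sq_lt_top x1 (h₁ b))
      (lintegral_windowMass_powerPiece_sq_lt_top x2 (h₂ b)) x3 ENNReal.ofReal_lt_top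
      (lintegral_powerPiece_lt_top (h₃ b))
  have hslab : MeasurableSet {u : ℝ × ℝ × ℝ | 0 < u.2.2 ∧ u.2.2 < x3} := by
    convert (measurableSet_Ioo (a := (0 : ℝ)) (b := x3)).preimage
      (f := fun u : ℝ × ℝ × ℝ => u.2.2) (by fun_prop) using 1
    ext u
    simp
  have hmw₁ : ∀ b, Measurable (windowMass x1 (φ₁ b)) := fun b => measurable_windowMass _ (hm₁ b)
  have hmw₂ : ∀ b, Measurable (windowMass x2 (φ₂ b)) := fun b => measurable_windowMass _ (hm₂ b)
  set G : Bool × Bool × Bool → ℝ × ℝ × ℝ → ℝ≥0∞ := fun b =>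
    {u : ℝ × ℝ × ℝ | 0 < u.2.2 ∧ u.2.2 < x3}.indicator
      (fun u => C b * (windowMass x1 (φ₁ b) u.1 *
        (windowMass x2 (φ₂ b) u.2.1 * ∫⁻ t, φ₃ b t))) with hG
  have hmG : ∀ b, Measurable (G b) := fun b => Measurable.indicator (by fun_prop) hslab
  calc _ ≤ ∫⁻ u, 8 * ∑ b, G b u ^ 2 := by
        refine lintegral_mono fun u => ?_
        have hsum := ENNReal.rpow_sum_le_const_mul_sum_rpow (Finset.univ)
          (fun b => G b u) (p := 2) one_le_two
        norm_num at hsum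
        refine le_trans (pow_le_pow_left' ?_ 2) hsum
        simp only [hG, Set.indicator_apply]
        split_ifs
        · exact hbound _ _
        · simp
    _ = 8 * ∑ b, ∫⁻ u, G b u ^ 2 := by
        rw [lintegral_const_mul _ (by fun_prop), lintegral_finsetSum _ (by fun_prop)]
    _ < ⊤ := ENNReal.mul_lt_top (by simp) (ENNReal.sum_lt_top.2 fun b _ => hfin b)
end
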